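/- For positive integers a, b, c with c odd, the number of solutions in positive integers (x, y, z) of the equation a^x + b^y = c^z is at most 2^ω(c), where ω(c) denotes the number of distinct prime factors of c. -/

import Mathlib

/-- The integer pair `(R_k, S_k)` with `(P r + Q s)^(2k+1) = P R_k r + Q S_k s`
where `A = (P r)^2`, `B = -(Q s)^2`. -/
def RS (A B : ℤ) : ℕ → ℤ × ℤ
  | 0 => (1, 1)
  | k + 1 => ((A - B) * (RS A B k).1 - 2 * B * (RS A B k).2,
      (A - B) * (RS A B k).2 + 2 * A * (RS A B k).1)

lemma RS_norm (A B : ℤ) (k : ℕ) :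
    A * (RS A B k).1 ^ 2 + B * (RS A B k).2 ^ 2 = (A + B) ^ (2 * k + 1) := by
  induction k with
  | zero => simp [RS]
  | succ k ih =>
    have : (A + B) ^ (2 * (k + 1) + 1) = (A + B) ^ (2 * k + 1) * (A + B) ^ 2 := by ring
    rw [this, ← ih]
    simp only [RS]
    ring

lemma RS_symm (A B : ℤ) (k : ℕ) :
    (RS A B k).1 = (-1) ^ k * (RS B A k).2 ∧ (RS A B k).2 = (-1) ^ k * (RS B A k).1 := by
  induction k with
  | zero => simp [RS]
  | succ k ih =>
    obtain ⟨h1, h2⟩ := ih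
    simp only [RS]
    rw [h1, h2]
    constructor <;> ring

lemma RS_mod (A B : ℤ) (k : ℕ) :
    (∃ X, (RS A B (k + 1)).1 = (2 * k + 3) * (-B) ^ (k + 1)
        + ((2 * k + 3).choose 3 : ℤ) * (-B) ^ k * A + A ^ 2 * X) ∧
    (∃ Y, (RS A B (k + 1)).2 = (-B) ^ (k + 1)
        + ((2 * k + 3).choose 2 : ℤ) * (-B) ^ k * A + A ^ 2 * Y) := by
  induction k with
  | zero =>
    refine ⟨⟨0, ?_⟩, ⟨0, ?_⟩⟩ <;> simp [RS, Nat.choose] <;> ring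
  | succ k ih =>
    obtain ⟨⟨X, hX⟩, ⟨Y, hY⟩⟩ := ih
    have e3 : ((2 * (k + 1) + 3).choose 3 : ℤ) = (2 * k + 3).choose 3 + 2 * (2 * k + 3).choose 2
        + (2 * k + 3) := by
      have h : (2 * (k + 1) + 3).choose 3 = (2 * k + 3).choose 3 + 2 * (2 * k + 3).choose 2
        + (2 * k + 3) := by
        have : 2 * (k + 1) + 3 = (2 * k + 3) + 1 + 1 := by ring
        rw [this]
        simp only [Nat.choose_succ_succ (2 * k + 3 + 1) 2, Nat.choose_succ_succ (2 * k + 3) 2,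
          Nat.choose_succ_succ (2 * k + 3) 1, Nat.choose_one_right]
        ring
      rw [h]; push_cast; ring
    have e2 : ((2 * (k + 1) + 3).choose 2 : ℤ) = (2 * k + 3).choose 2 + 2 * (2 * k + 3) + 1 := by
      have h : (2 * (k + 1) + 3).choose 2 = (2 * k + 3).choose 2 + 2 * (2 * k + 3) + 1 := by
        have : 2 * (k + 1) + 3 = (2 * k + 3) + 1 + 1 := by ring
        rw [this]
        simp only [Nat.choose_succ_succ (2 * k + 3 + 1) 1, Nat.choose_succ_succ (2 * k + 3) 1,
          Nat.choose_one_right]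
        ring
      rw [h]; push_cast; ring
    rw [show RS A B (k + 1 + 1) = ((A - B) * (RS A B (k + 1)).1 - 2 * B * (RS A B (k + 1)).2,
      (A - B) * (RS A B (k + 1)).2 + 2 * A * (RS A B (k + 1)).1) from rfl]
    simp only [hX, hY, e3, e2]
    constructor
    · refine ⟨(A - B) * X - 2 * B * Y + ((2 * k + 3).choose 3 : ℤ) * (-B) ^ k, ?_⟩
      push_cast
      ring
    · refine ⟨(A - B) * Y + 2 * A * X + 2 * ((2 * k + 3).choose 3 : ℤ) * (-B) ^ k
        + ((2 * k + 3).choose 2 : ℤ) * (-B) ^ k, ?_⟩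
      push_cast
      ring

/-- If all primes dividing `R` divide `A`, they are equal to `2k+1`. -/
lemma R_prime (A B : ℤ) (hAB : IsCoprime A B) (k : ℕ) (hq : (2 * k + 3).Prime) (p : ℕ)
    (hp : p.Prime) (hpR : (p : ℤ) ∣ (RS A B (k + 1)).1) (hpA : (p : ℤ) ∣ A) : p = 2 * k + 3 := by
  obtain ⟨⟨X, hX⟩, -⟩ := RS_mod A B k
  have hp' : Prime (p : ℤ) := Nat.prime_iff_prime_int.mp hp
  have h1 : (p : ℤ) ∣ (2 * k + 3) * (-B) ^ (k + 1) := by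
    have : (2 * (k : ℤ) + 3) * (-B) ^ (k + 1) = (RS A B (k + 1)).1
        - A * (((2 * k + 3).choose 3 : ℤ) * (-B) ^ k + A * X) := by rw [hX]; ring
    rw [this]
    exact dvd_sub hpR (Dvd.dvd.mul_right hpA _)
  rcases hp'.dvd_or_dvd h1 with h | h
  · have : p ∣ 2 * k + 3 := by exact_mod_cast h
    exact (Nat.prime_dvd_prime_iff_eq hp hq).mp this
  · have h2 := hp'.dvd_of_dvd_pow h
    rw [dvd_neg] at h2
    exact absurd (hAB.isUnit_of_dvd' hpA h2) hp'.not_isUnit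

lemma R_small (A B : ℤ) (hAB : IsCoprime A B) (k : ℕ) (hk : 1 ≤ k) (hq : (2 * k + 3).Prime)
    (h0 : (RS A B (k + 1)).1 ≠ 0)
    (hR : ∀ p : ℕ, p.Prime → (p : ℤ) ∣ (RS A B (k + 1)).1 → (p : ℤ) ∣ A) :
    (RS A B (k + 1)).1 ^ 2 ≤ (2 * k + 3) ^ 2 := by
  set R := (RS A B (k + 1)).1 with hRdef
  have hn : R.natAbs ≠ 0 := by simpa using h0
  have hall : ∀ {d : ℕ}, d.Prime → d ∣ R.natAbs → d = 2 * k + 3 := by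
    intro d hd hdR
    have : (d : ℤ) ∣ R := Int.natCast_dvd.mpr hdR
    exact R_prime A B hAB k hq d hd this (hR d hd this)
  have hpow := Nat.eq_prime_pow_of_unique_prime_dvd hn hall
  set j := R.natAbs.primeFactorsList.length
  have hj : j ≤ 1 := by
    by_contra hj
    push Not at hj
    have hsq : (2 * k + 3) ^ 2 ∣ R.natAbs := by
      rw [hpow]; exact pow_dvd_pow _ hj
    have hsq' : ((2 * k + 3 : ℕ) : ℤ) ^ 2 ∣ R := by
      have := Int.natCast_dvd.mpr hsq
      exact_mod_cast this
    have hqR : ((2 * k + 3 : ℕ) : ℤ) ∣ R := dvd_trans (dvd_pow_self _ two_ne_zero) hsq'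
    have hqA := hR _ hq hqR
    obtain ⟨⟨X, hX⟩, -⟩ := RS_mod A B k
    have hc : ((2 * k + 3 : ℕ) : ℤ) ∣ ((2 * k + 3).choose 3 : ℤ) := by
      exact_mod_cast hq.dvd_choose_self (by norm_num) (by omega)
    obtain ⟨u, hu⟩ := hqA
    obtain ⟨w, hw⟩ := hc
    obtain ⟨v, hv⟩ := hsq'
    rw [← hRdef, hv, hw] at hX
    have hne : ((2 * k + 3 : ℕ) : ℤ) ≠ 0 := by positivity
    have h2 : ((2 * k + 3 : ℕ) : ℤ) ∣ (-B) ^ (k + 1) := by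
      refine ⟨v - w * (-B) ^ k * u - u ^ 2 * X, ?_⟩
      apply mul_left_cancel₀ hne
      rw [hu] at hX
      push_cast at hX ⊢
      linear_combination -hX
    have hp' : Prime ((2 * k + 3 : ℕ) : ℤ) := Nat.prime_iff_prime_int.mp hq
    have h3 := hp'.dvd_of_dvd_pow h2
    rw [dvd_neg] at h3
    exact hp'.not_isUnit (hAB.isUnit_of_dvd' ⟨u, hu⟩ h3)
  have hle : R.natAbs ≤ 2 * k + 3 := by
    rw [hpow]
    calc (2 * k + 3) ^ j ≤ (2 * k + 3) ^ 1 := Nat.pow_le_pow_right (by omega) hj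
      _ = _ := by simp
  have : |R| ≤ 2 * k + 3 := by
    rw [Int.abs_eq_natAbs]; exact_mod_cast hle
  calc R ^ 2 = |R| ^ 2 := (sq_abs R).symm
    _ ≤ _ := by gcongr

lemma no_big (A B : ℤ) (hA : 2 ≤ A) (hB : 2 ≤ B) (hAB : IsCoprime A B) (k : ℕ) (hk : 1 ≤ k)
    (hq : (2 * k + 3).Prime)
    (h1 : (RS A B (k + 1)).1 ≠ 0) (h2 : (RS A B (k + 1)).2 ≠ 0)
    (hR : ∀ p : ℕ, p.Prime → (p : ℤ) ∣ (RS A B (k + 1)).1 → (p : ℤ) ∣ A)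
    (hS : ∀ p : ℕ, p.Prime → (p : ℤ) ∣ (RS A B (k + 1)).2 → (p : ℤ) ∣ B) : False := by
  have r1 := R_small A B hAB k hk hq h1 hR
  have r2 : (RS A B (k + 1)).2 ^ 2 ≤ (2 * k + 3) ^ 2 := by
    have e := (RS_symm A B (k + 1)).2
    have e2 : (RS B A (k + 1)).1 = (-1) ^ (k + 1) * (RS A B (k + 1)).2 := by
      exact (RS_symm B A (k + 1)).1
    have := R_small B A hAB.symm k hk hq (by rw [e2]; simp [h2]) (by
      intro p hp h
      apply hS p hp
      rw [e]
      exact Dvd.dvd.mul_left h _)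
    rw [e, mul_pow, ← pow_mul, mul_comm (k + 1) 2, pow_mul]
    simpa using this
  have hn := RS_norm A B (k + 1)
  have hle : (A + B) ^ (2 * (k + 1) + 1) ≤ (A + B) * (2 * k + 3) ^ 2 := by
    rw [← hn]; nlinarith
  have hpos : 0 < A + B := by linarith
  have hle2 : (A + B) ^ (2 * (k + 1)) ≤ (2 * k + 3) ^ 2 := by
    rw [pow_succ, mul_comm] at hle
    exact le_of_mul_le_mul_left hle hpos
  have hle3 : (A + B) ^ (k + 1) ≤ 2 * k + 3 := by
    rw [mul_comm 2, pow_mul] at hle2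
    exact le_of_sq_le_sq hle2 (by positivity)
  have h4 : (4 : ℤ) ^ (k + 1) ≤ (A + B) ^ (k + 1) := by gcongr; linarith
  have h5 : ∀ n : ℕ, 2 * (n : ℤ) + 3 < 4 ^ (n + 1) := by
    intro n
    induction n with
    | zero => norm_num
    | succ n ih => rw [pow_succ]; push_cast; linarith
  linarith [h5 k]
lemma pow_eq_ten (a x : ℕ) (h : a ^ x = 10) : a = 10 ∧ x = 1 := by
  have hx : x ≠ 0 := by rintro rfl; simp at h
  have h2 : 2 ∣ a := Nat.prime_two.dvd_of_dvd_pow (n := x) (by rw [h]; norm_num)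
  have h5 : 5 ∣ a := Nat.prime_five.dvd_of_dvd_pow (n := x) (by rw [h]; norm_num)
  have h10 : a ∣ 10 := by rw [← h]; exact dvd_pow_self _ hx
  have hle := Nat.le_of_dvd (by norm_num) h10
  have ha : a = 10 := by
    have : a ≠ 0 := by rintro rfl; simp at h10
    omega
  refine ⟨ha, ?_⟩
  rw [ha] at h
  exact Nat.pow_right_injective (le_refl _ |>.trans (by norm_num : 2 ≤ 10)) (by simpa using h)

lemma pow_eq_thirteen (c g : ℕ) (h : c ^ g = 13) : c = 13 := by
  have hx : g ≠ 0 := by rintro rfl; simp at h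
  have h10 : c ∣ 13 := by rw [← h]; exact dvd_pow_self _ hx
  rcases (Nat.dvd_prime (by norm_num)).mp h10 with h1 | h1
  · rw [h1] at h; simp at h
  · exact h1

lemma cube_case (a b c : ℕ) (f g x y : ℕ) (hf : f ≤ 1) (A B Q : ℤ)
    (hA : 2 ≤ A) (hB : 2 ≤ B) (hAB : IsCoprime A B) (hBQ : B = b ^ f * Q ^ 2)
    (hR : ∀ p : ℕ, p.Prime → (p : ℤ) ∣ (RS A B 1).1 → (p : ℤ) ∣ A)
    (hS : ∀ p : ℕ, p.Prime → (p : ℤ) ∣ (RS A B 1).2 → (p : ℤ) ∣ B)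
    (h0 : (RS A B 1).2 ≠ 0)
    (h3 : ¬ (3 : ℤ) ∣ A)
    (hx : A * (RS A B 1).1 ^ 2 = a ^ x) (hy : B * (RS A B 1).2 ^ 2 = b ^ y)
    (hc : A + B = c ^ g) : a = 10 ∧ b = 3 ∧ c = 13 ∧ x = 1 ∧ y = 7 := by
  have eR : (RS A B 1).1 = A - 3 * B := by simp [RS]; ring
  have eS : (RS A B 1).2 = 3 * A - B := by simp [RS]; ring
  have hR1 : (A - 3 * B).natAbs = 1 := by
    rw [Nat.eq_one_iff_not_exists_prime_dvd]
    intro p hp hd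
    have hd' : (p : ℤ) ∣ (RS A B 1).1 := by rw [eR]; exact Int.natCast_dvd.mpr hd
    have := R_prime A B hAB 0 (by norm_num) p hp hd' (hR p hp hd')
    subst this
    exact h3 (by simpa using hR _ hp hd')
  have hSp : ∀ {d : ℕ}, d.Prime → d ∣ (3 * A - B).natAbs → d = 3 := by
    intro p hp hd
    have hd' : (p : ℤ) ∣ (RS A B 1).2 := by rw [eS]; exact Int.natCast_dvd.mpr hd
    have hs := (RS_symm B A 1).1
    exact R_prime B A hAB.symm 0 (by norm_num) p hp (by rw [hs]; exact Dvd.dvd.mul_left hd' _)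
      (hS p hp hd')
  rw [eS] at h0
  have hpow := Nat.eq_prime_pow_of_unique_prime_dvd (by simpa using h0) hSp
  set j := (3 * A - B).natAbs.primeFactorsList.length with hj
  clear_value j
  have h3B : (3 : ℤ) ∣ B := by
    by_contra hcon
    rcases Nat.eq_zero_or_pos j with hj0 | hj0
    · rw [hj0] at hpow; simp at hpow; omega
    · apply hcon
      have := hS 3 (by norm_num) (by
        rw [eS]; apply Int.natCast_dvd.mpr; rw [hpow]; exact dvd_pow_self _ hj0.ne')
      simpa using this
  have hj1 : j ≠ 0 := by
    rintro rfl
    simp at hpow; omega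
  have h9B : ¬ (9 : ℤ) ∣ B := by
    intro h9
    have hj2 : ¬ 2 ≤ j := by
      intro hj2
      have : (3 ^ 2 : ℕ) ∣ (3 * A - B).natAbs := by rw [hpow]; exact pow_dvd_pow _ hj2
      omega
    have : j = 1 := by omega
    rw [this] at hpow
    omega
  have hf1 : f = 1 := by
    by_contra hf1
    have : f = 0 := by omega
    rw [this] at hBQ
    simp only [pow_zero, one_mul] at hBQ
    apply h9B
    rw [hBQ] at h3B ⊢
    have := (Int.prime_three.dvd_of_dvd_pow h3B)
    have := pow_dvd_pow_of_dvd this 2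
    norm_num at this; exact this
  rw [hf1, pow_one] at hBQ
  have h3b : (3 : ℤ) ∣ b := by
    rw [hBQ] at h3B
    rcases Int.prime_three.dvd_or_dvd h3B with h | h
    · exact h
    · exfalso; apply h9B
      have := pow_dvd_pow_of_dvd (Int.prime_three.dvd_of_dvd_pow h) 2
      norm_num at this; rw [hBQ]; exact Dvd.dvd.mul_left this _
  have h3b' : 3 ∣ b := by exact_mod_cast h3b
  obtain ⟨n, rfl⟩ := h3b'
  have hn3 : ¬ 3 ∣ n := by
    rintro ⟨t, rfl⟩
    apply h9B; rw [hBQ]; exact ⟨t * Q ^ 2, by push_cast; ring⟩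
  obtain ⟨m', hm'⟩ := h3B
  obtain ⟨m, rfl⟩ : ∃ m : ℕ, m' = m := ⟨m'.toNat, by omega⟩
  have hm3 : ¬ 3 ∣ m := by
    rintro ⟨t, rfl⟩
    apply h9B; rw [hm']; exact ⟨t, by push_cast; ring⟩
  have hmpos : 0 < m := by omega
  have hnpos : 0 < n := by
    rcases Nat.eq_zero_or_pos n with h | h
    · subst h; simp at hn3
    · exact h
  have hSsq : (3 * A - B) ^ 2 = (3 : ℤ) ^ (2 * j) := by
    rw [← Int.natAbs_sq, hpow]; push_cast; ring
  have hmain : (3 * n) ^ y = 3 ^ (2 * j + 1) * m := by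
    rw [eS, hSsq, hm'] at hy
    have : (((3 * n) ^ y : ℕ) : ℤ) = ((3 ^ (2 * j + 1) * m : ℕ) : ℤ) := by
      push_cast; push_cast at hy; rw [← hy]; ring
    exact_mod_cast this
  have hy' : y = 2 * j + 1 := by
    have := congrArg (padicValNat 3) hmain
    rw [padicValNat.pow, padicValNat.mul (by norm_num) (by positivity),
      padicValNat.mul (by positivity) (by positivity), padicValNat.prime_pow,
      padicValNat.eq_zero_of_not_dvd hn3, padicValNat.eq_zero_of_not_dvd hm3] at this
    simpa using this
  have hmn : m = n ^ (2 * j + 1) := by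
    rw [hy', mul_pow] at hmain
    exact (Nat.eq_of_mul_eq_mul_left (by positivity) hmain).symm
  have hn1 : n = 1 := by
    by_contra hn1
    have hn2 : 2 ≤ n := by omega
    have h1 : 2 ^ (2 * j + 1) ≤ m := by rw [hmn]; exact Nat.pow_le_pow_left hn2 _
    have h2 : 3 ^ j ≤ 4 ^ j := Nat.pow_le_pow_left (by norm_num) j
    have h3 : 2 ^ (2 * j + 1) = 2 * 4 ^ j := by rw [pow_succ, pow_mul]; ring
    omega
  subst hn1
  have hm1 : m = 1 := by simpa using hmn
  subst hm1
  have hB3 : B = 3 := by simpa using hm'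
  have hA' : A = 10 ∨ A = 8 := by omega
  have hj3 : j = 3 ∧ A = 10 := by
    have hj4 : j < 4 := by
      by_contra h
      push Not at h
      have : 3 ^ 4 ≤ 3 ^ j := Nat.pow_le_pow_right (by norm_num) h
      omega
    interval_cases j <;> omega
  obtain ⟨rfl, rfl⟩ := hj3
  subst hB3
  obtain ⟨h1, h2⟩ := pow_eq_ten a x (by
    rw [eR] at hx; norm_num at hx; exact_mod_cast hx.symm)
  have h3 := pow_eq_thirteen c g (by norm_num at hc; exact_mod_cast hc.symm)
  exact ⟨h1, by norm_num, h3, h2, by omega⟩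

lemma endgame (a b c : ℕ) (ha : 2 ≤ a) (hb : 2 ≤ b) (hab : a.Coprime b)
    (e f g x y k : ℕ) (he : e ≤ 1) (hf : f ≤ 1) (P Q : ℤ) (A B : ℤ)
    (hAP : A = a ^ e * P ^ 2) (hBQ : B = b ^ f * Q ^ 2)
    (hradA : ∀ p : ℕ, p.Prime → p ∣ a → (p : ℤ) ∣ a ^ e * P)
    (hradB : ∀ p : ℕ, p.Prime → p ∣ b → (p : ℤ) ∣ b ^ f * Q)
    (hc : A + B = c ^ g) (hk : (2 * k + 3).Prime)
    (hx : A * (RS A B (k + 1)).1 ^ 2 = a ^ x) (hy : B * (RS A B (k + 1)).2 ^ 2 = b ^ y) :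
    (a = 10 ∧ b = 3 ∧ c = 13 ∧ x = 1 ∧ y = 7) ∨ (a = 3 ∧ b = 10 ∧ c = 13 ∧ x = 7 ∧ y = 1) := by
  have hradA' : ∀ p : ℕ, p.Prime → p ∣ a → (p : ℤ) ∣ A := by
    intro p hp h
    rw [hAP, pow_two, ← mul_assoc]; exact Dvd.dvd.mul_right (hradA p hp h) _
  have hradB' : ∀ p : ℕ, p.Prime → p ∣ b → (p : ℤ) ∣ B := by
    intro p hp h
    rw [hBQ, pow_two, ← mul_assoc]; exact Dvd.dvd.mul_right (hradB p hp h) _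
  have hax : (a : ℤ) ^ x ≠ 0 := by positivity
  have hby : (b : ℤ) ^ y ≠ 0 := by positivity
  have hA0 : A ≠ 0 := by rintro h; rw [h] at hx; simp at hx; exact hax hx.symm
  have hB0 : B ≠ 0 := by rintro h; rw [h] at hy; simp at hy; exact hby hy.symm
  have hR0 : (RS A B (k + 1)).1 ≠ 0 := by rintro h; rw [h] at hx; simp at hx; exact hax hx.symm
  have hS0 : (RS A B (k + 1)).2 ≠ 0 := by rintro h; rw [h] at hy; simp at hy; exact hby hy.symm
  have hApos : 0 ≤ A := by rw [hAP]; positivity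
  have hBpos : 0 ≤ B := by rw [hBQ]; positivity
  have hA2 : 2 ≤ A := by
    obtain ⟨p, hp, hpa⟩ := Nat.exists_prime_and_dvd (show a ≠ 1 by omega)
    have := Int.le_of_dvd (by omega) (hradA' p hp hpa)
    have := hp.two_le
    omega
  have hB2 : 2 ≤ B := by
    obtain ⟨p, hp, hpa⟩ := Nat.exists_prime_and_dvd (show b ≠ 1 by omega)
    have := Int.le_of_dvd (by omega) (hradB' p hp hpa)
    have := hp.two_le
    omega
  have hAB : IsCoprime A B := by
    have h1 : IsCoprime ((a : ℤ) ^ x) ((b : ℤ) ^ y) := (Nat.isCoprime_iff_coprime.mpr hab).pow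
    rw [← hx, ← hy] at h1
    exact h1.of_mul_left_left.of_mul_right_left
  have hR : ∀ p : ℕ, p.Prime → (p : ℤ) ∣ (RS A B (k + 1)).1 → (p : ℤ) ∣ A := by
    intro p hp h
    apply hradA' p hp
    have : (p : ℤ) ∣ (a : ℤ) ^ x := by
      rw [← hx, pow_two]; exact Dvd.dvd.mul_left (Dvd.dvd.mul_left h _) _
    have : p ∣ a ^ x := by exact_mod_cast this
    exact hp.dvd_of_dvd_pow this
  have hS : ∀ p : ℕ, p.Prime → (p : ℤ) ∣ (RS A B (k + 1)).2 → (p : ℤ) ∣ B := by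
    intro p hp h
    apply hradB' p hp
    have : (p : ℤ) ∣ (b : ℤ) ^ y := by
      rw [← hy, pow_two]; exact Dvd.dvd.mul_left (Dvd.dvd.mul_left h _) _
    have : p ∣ b ^ y := by exact_mod_cast this
    exact hp.dvd_of_dvd_pow this
  rcases Nat.eq_zero_or_pos k with hk0 | hk0
  · subst hk0
    simp only [zero_add] at *
    by_cases h3 : (3 : ℤ) ∣ A
    · right
      have h3B : ¬ (3 : ℤ) ∣ B := fun h => Int.prime_three.not_isUnit (hAB.isUnit_of_dvd' h3 h)
      obtain ⟨s1, s2⟩ := RS_symm B A 1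
      obtain ⟨h1, h2, h3, h4, h5⟩ := cube_case b a c e g y x he B A P hB2 hA2 hAB.symm hAP
        (by intro p hp h; rw [s1] at h; exact hS p hp (by simpa using h))
        (by intro p hp h; rw [s2] at h; exact hR p hp (by simpa using h))
        (by rw [s2]; simpa using hR0) h3B (by rw [s1, ← hy]; ring) (by rw [s2, ← hx]; ring)
        (by rw [← hc]; ring)
      exact ⟨h2, h1, h3, h5, h4⟩
    · left
      exact cube_case a b c f g x y hf A B Q hA2 hB2 hAB hBQ hR hS hS0 h3 hx hy hc
  · exact (no_big A B hA2 hB2 hAB k hk0 hk hR0 hS0 hR hS).elim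
/-- Data of an odd type element `P r + Q s` of norm `c^z`. -/
structure OG (a b c : ℕ) (A B ρ : ℤ) (P Q : ℤ) (z : ℕ) : Prop where
  norm : A * P ^ 2 + B * Q ^ 2 = (c : ℤ) ^ z
  phi : (c : ℤ) ^ z ∣ P + Q * ρ
  radA : ∀ p : ℕ, p.Prime → p ∣ a → (p : ℤ) ∣ A * P
  radB : ∀ p : ℕ, p.Prime → p ∣ b → (p : ℤ) ∣ B * Q

/-- Data of an even type element `U + V r s` of norm `c^z`. -/
structure EG (a b c : ℕ) (A B ρ : ℤ) (U V : ℤ) (z : ℕ) : Prop where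
  norm : U ^ 2 + A * B * V ^ 2 = (c : ℤ) ^ z
  phi : (c : ℤ) ^ z ∣ U + A * V * ρ
  radA : ∀ p : ℕ, p.Prime → p ∣ a → (p : ℤ) ∣ A * B * V
  radB : ∀ p : ℕ, p.Prime → p ∣ b → (p : ℤ) ∣ A * B * V

lemma prime_cancel {a c : ℕ} (hac : a.Coprime c) {p : ℕ} (hp : p.Prime) (hpa : p ∣ a) (z : ℕ)
    {X : ℤ} (h : (p : ℤ) ∣ (c : ℤ) ^ z * X) : (p : ℤ) ∣ X := by
  have hp' : Prime (p : ℤ) := Nat.prime_iff_prime_int.mp hp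
  rcases hp'.dvd_or_dvd h with h1 | h1
  · exfalso
    have : p ∣ c := by exact_mod_cast hp'.dvd_of_dvd_pow h1
    exact hp.one_lt.ne' (Nat.eq_one_of_dvd_coprimes hac hpa this)
  · exact h1

section
variable {a b c : ℕ} {A B ρ : ℤ} {N : ℕ}

lemma div_OO (hc : 0 < c) (hac : a.Coprime c) (hbc : b.Coprime c)
    (hρ : (c : ℤ) ^ N ∣ A * ρ ^ 2 + B) {K : Type*} [Field K] [CharZero K] {r s : K}
    (hr : r ^ 2 = A) (hs : s ^ 2 = -B)
    {P₁ Q₁ P₂ Q₂ : ℤ} {z₁ z₂ : ℕ} (h1 : OG a b c A B ρ P₁ Q₁ z₁) (h2 : OG a b c A B ρ P₂ Q₂ z₂)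
    (hz : z₁ ≤ z₂) (hN : z₂ ≤ N) :
    ∃ U V : ℤ, EG a b c A B ρ U V (z₂ - z₁) ∧
      (P₂ * r + Q₂ * s : K) = (P₁ * r + Q₁ * s) * (U + V * (r * s)) := by
  have hc0 : (c : ℤ) ^ z₁ ≠ 0 := by positivity
  obtain ⟨k, hk⟩ := h1.phi
  obtain ⟨l, hl⟩ := h2.phi
  obtain ⟨n, hn⟩ := dvd_trans (pow_dvd_pow (c : ℤ) hN) hρ
  have hsplit : (c : ℤ) ^ z₂ = (c : ℤ) ^ z₁ * (c : ℤ) ^ (z₂ - z₁) := by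
    rw [← pow_add]; congr 1; omega
  have n1 := h1.norm
  have n2 := h2.norm
  set C := (c : ℤ) ^ z₁ with hC
  set D := (c : ℤ) ^ (z₂ - z₁) with hD
  rw [hsplit] at hl hn n2
  have eP1 : P₁ = C * k - Q₁ * ρ := by linarith
  have eP2 : P₂ = C * D * l - Q₂ * ρ := by linarith
  have dU : C ∣ A * P₁ * P₂ + B * Q₁ * Q₂ := by
    refine ⟨A * k * P₂ - A * Q₁ * ρ * D * l + Q₁ * Q₂ * D * n, ?_⟩
    rw [eP1, eP2]
    linear_combination Q₁ * Q₂ * hn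
  have dV : C ∣ P₁ * Q₂ - Q₁ * P₂ := by
    refine ⟨k * Q₂ - Q₁ * D * l, ?_⟩
    rw [eP1, eP2]; ring
  obtain ⟨U, hU⟩ := dU
  obtain ⟨V, hV⟩ := dV
  refine ⟨U, V, ⟨?_, ?_, ?_, ?_⟩, ?_⟩
  · apply mul_left_cancel₀ (pow_ne_zero 2 hc0)
    calc C ^ 2 * (U ^ 2 + A * B * V ^ 2) = (C * U) ^ 2 + A * B * (C * V) ^ 2 := by ring
      _ = (A * P₁ ^ 2 + B * Q₁ ^ 2) * (A * P₂ ^ 2 + B * Q₂ ^ 2) := by rw [← hU, ← hV]; ring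
      _ = C ^ 2 * D := by rw [n1, n2]; ring
  · refine ⟨A * (P₁ - ρ * Q₁) * l + Q₁ * Q₂ * n, ?_⟩
    apply mul_left_cancel₀ hc0
    have : C * (U + A * V * ρ) = (C * U) + A * (C * V) * ρ := by ring
    rw [this, ← hU, ← hV]
    linear_combination Q₁ * Q₂ * hn + A * (P₁ - ρ * Q₁) * hl
  · intro p hp hpa
    apply prime_cancel hac hp hpa z₁
    have : C * (A * B * V) = B * ((A * P₁) * Q₂ - (A * P₂) * Q₁) := by
      linear_combination -A * B * hV
    rw [← hC, this]
    exact Dvd.dvd.mul_left (dvd_sub (Dvd.dvd.mul_right (h1.radA p hp hpa) _)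
      (Dvd.dvd.mul_right (h2.radA p hp hpa) _)) _
  · intro p hp hpa
    apply prime_cancel hbc hp hpa z₁
    have : C * (A * B * V) = A * ((B * Q₂) * P₁ - (B * Q₁) * P₂) := by
      linear_combination -A * B * hV
    rw [← hC, this]
    exact Dvd.dvd.mul_left (dvd_sub (Dvd.dvd.mul_right (h2.radB p hp hpa) _)
      (Dvd.dvd.mul_right (h1.radB p hp hpa) _)) _
  · have hcK : (C : K) ≠ 0 := by exact_mod_cast hc0
    apply mul_left_cancel₀ hcK
    have hU' : (A * P₁ * P₂ + B * Q₁ * Q₂ : K) = C * U := by exact_mod_cast hU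
    have hV' : (P₁ * Q₂ - Q₁ * P₂ : K) = C * V := by exact_mod_cast hV
    have n1' : (A * P₁ ^ 2 + B * Q₁ ^ 2 : K) = C := by exact_mod_cast n1
    have e1 : (C : K) * ((P₁ * r + Q₁ * s) * (U + V * (r * s)))
      = (P₁ * r + Q₁ * s) * (C * U + C * V * (r * s)) := by ring
    rw [e1, ← hU', ← hV', ← n1']
    rw [← hr, show (B : K) = - s ^ 2 by rw [hs]; ring]
    ring

lemma div_OE (hc : 0 < c) (hac : a.Coprime c) (hbc : b.Coprime c)
    (hρ : (c : ℤ) ^ N ∣ A * ρ ^ 2 + B) {K : Type*} [Field K] [CharZero K] {r s : K}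
    (hr : r ^ 2 = A) (hs : s ^ 2 = -B)
    {P Q U V : ℤ} {z₁ z₂ : ℕ} (h1 : OG a b c A B ρ P Q z₁) (h2 : EG a b c A B ρ U V z₂)
    (hz : z₁ ≤ z₂) (hN : z₂ ≤ N) :
    ∃ P' Q' : ℤ, OG a b c A B ρ P' Q' (z₂ - z₁) ∧
      (U + V * (r * s) : K) = (P * r + Q * s) * (P' * r + Q' * s) := by
  have hc0 : (c : ℤ) ^ z₁ ≠ 0 := by positivity
  obtain ⟨k, hk⟩ := h1.phi
  obtain ⟨l, hl⟩ := h2.phi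
  obtain ⟨n, hn⟩ := dvd_trans (pow_dvd_pow (c : ℤ) hN) hρ
  have hsplit : (c : ℤ) ^ z₂ = (c : ℤ) ^ z₁ * (c : ℤ) ^ (z₂ - z₁) := by
    rw [← pow_add]; congr 1; omega
  have n1 := h1.norm
  have n2 := h2.norm
  set C := (c : ℤ) ^ z₁ with hC
  set D := (c : ℤ) ^ (z₂ - z₁) with hD
  rw [hsplit] at hl hn n2
  have dU : C ∣ P * U + Q * V * B := by
    refine ⟨k * U - Q * ρ * D * l + Q * V * D * n, ?_⟩
    linear_combination U * hk - Q * ρ * hl + Q * V * hn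
  have dV : C ∣ (P * V * A - Q * U) := by
    refine ⟨k * V * A - Q * D * l, ?_⟩
    linear_combination V * A * hk - Q * hl
  obtain ⟨P', hU⟩ := dU
  obtain ⟨Q', hV⟩ := dV
  refine ⟨P', Q', ⟨?_, ?_, ?_, ?_⟩, ?_⟩
  · apply mul_left_cancel₀ (pow_ne_zero 2 hc0)
    calc C ^ 2 * (A * P' ^ 2 + B * Q' ^ 2) = A * (C * P') ^ 2 + B * (C * Q') ^ 2 := by ring
      _ = (A * P ^ 2 + B * Q ^ 2) * (U ^ 2 + A * B * V ^ 2) := by rw [← hU, ← hV]; ring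
      _ = C ^ 2 * D := by rw [n1, n2]; ring
  · refine ⟨(P - ρ * Q) * l + Q * V * n, ?_⟩
    apply mul_left_cancel₀ hc0
    have : C * (P' + Q' * ρ) = (C * P') + (C * Q') * ρ := by ring
    rw [this, ← hU, ← hV]
    linear_combination (P - ρ * Q) * hl + Q * V * hn
  · intro p hp hpa
    apply prime_cancel hac hp hpa z₁
    have : C * (A * P') = (A * P) * U + (A * B * V) * Q := by
      linear_combination -A * hU
    rw [← hC, this]
    exact dvd_add (Dvd.dvd.mul_right (h1.radA p hp hpa) _)
      (Dvd.dvd.mul_right (h2.radA p hp hpa) _)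
  · intro p hp hpa
    apply prime_cancel hbc hp hpa z₁
    have : C * (B * Q') = ((A * B * V) * P - (B * Q) * U) := by
      linear_combination -B * hV
    rw [← hC, this]
    exact dvd_sub (Dvd.dvd.mul_right (h2.radB p hp hpa) _)
      (Dvd.dvd.mul_right (h1.radB p hp hpa) _)
  · have hcK : (C : K) ≠ 0 := by exact_mod_cast hc0
    apply mul_left_cancel₀ hcK
    have hU' : (P * U + Q * V * B : K) = C * P' := by exact_mod_cast hU
    have hV' : ((P * V * A - Q * U) : K) = C * Q' := by exact_mod_cast hV
    have n1' : (A * P ^ 2 + B * Q ^ 2 : K) = C := by exact_mod_cast n1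
    have e1 : (C : K) * ((P * r + Q * s) * (P' * r + Q' * s))
      = (P * r + Q * s) * (C * P' * r + C * Q' * s) := by ring
    rw [e1, ← hU', ← hV', ← n1']
    rw [← hr, show (B : K) = - s ^ 2 by rw [hs]; ring]
    ring

lemma div_EO (hc : 0 < c) (hac : a.Coprime c) (hbc : b.Coprime c)
    (hρ : (c : ℤ) ^ N ∣ A * ρ ^ 2 + B) {K : Type*} [Field K] [CharZero K] {r s : K}
    (hr : r ^ 2 = A) (hs : s ^ 2 = -B)
    {P Q U V : ℤ} {z₁ z₂ : ℕ} (h1 : EG a b c A B ρ U V z₁) (h2 : OG a b c A B ρ P Q z₂)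
    (hz : z₁ ≤ z₂) (hN : z₂ ≤ N) :
    ∃ P' Q' : ℤ, OG a b c A B ρ P' Q' (z₂ - z₁) ∧
      (P * r + Q * s : K) = (U + V * (r * s)) * (P' * r + Q' * s) := by
  have hc0 : (c : ℤ) ^ z₁ ≠ 0 := by positivity
  obtain ⟨k, hk⟩ := h1.phi
  obtain ⟨l, hl⟩ := h2.phi
  obtain ⟨n, hn⟩ := dvd_trans (pow_dvd_pow (c : ℤ) hN) hρ
  have hsplit : (c : ℤ) ^ z₂ = (c : ℤ) ^ z₁ * (c : ℤ) ^ (z₂ - z₁) := by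
    rw [← pow_add]; congr 1; omega
  have n1 := h1.norm
  have n2 := h2.norm
  set C := (c : ℤ) ^ z₁ with hC
  set D := (c : ℤ) ^ (z₂ - z₁) with hD
  rw [hsplit] at hl hn n2
  have dU : C ∣ P * U + Q * V * B := by
    refine ⟨D * l * U - Q * ρ * k + Q * V * D * n, ?_⟩
    linear_combination U * hl - Q * ρ * hk + Q * V * hn
  have dV : C ∣ -(P * V * A - Q * U) := by
    refine ⟨-(D * l * V * A - Q * k), ?_⟩
    linear_combination -V * A * hl + Q * hk
  obtain ⟨P', hU⟩ := dU
  obtain ⟨Q', hV⟩ := dV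
  refine ⟨P', Q', ⟨?_, ?_, ?_, ?_⟩, ?_⟩
  · apply mul_left_cancel₀ (pow_ne_zero 2 hc0)
    calc C ^ 2 * (A * P' ^ 2 + B * Q' ^ 2) = A * (C * P') ^ 2 + B * (C * Q') ^ 2 := by ring
      _ = (A * P ^ 2 + B * Q ^ 2) * (U ^ 2 + A * B * V ^ 2) := by rw [← hU, ← hV]; ring
      _ = C ^ 2 * D := by rw [n1, n2]; ring
  · refine ⟨(U - ρ * A * V) * l + Q * V * n, ?_⟩
    apply mul_left_cancel₀ hc0
    have : C * (P' + Q' * ρ) = (C * P') + (C * Q') * ρ := by ring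
    rw [this, ← hU, ← hV]
    linear_combination (U - ρ * A * V) * hl + Q * V * hn
  · intro p hp hpa
    apply prime_cancel hac hp hpa z₁
    have : C * (A * P') = (A * P) * U + (A * B * V) * Q := by
      linear_combination -A * hU
    rw [← hC, this]
    exact dvd_add (Dvd.dvd.mul_right (h2.radA p hp hpa) _)
      (Dvd.dvd.mul_right (h1.radA p hp hpa) _)
  · intro p hp hpa
    apply prime_cancel hbc hp hpa z₁
    have : C * (B * Q') = -((A * B * V) * P - (B * Q) * U) := by
      linear_combination -B * hV
    rw [← hC, this]
    rw [dvd_neg]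
    exact dvd_sub (Dvd.dvd.mul_right (h1.radB p hp hpa) _)
      (Dvd.dvd.mul_right (h2.radB p hp hpa) _)
  · have hcK : (C : K) ≠ 0 := by exact_mod_cast hc0
    apply mul_left_cancel₀ hcK
    have hU' : (P * U + Q * V * B : K) = C * P' := by exact_mod_cast hU
    have hV' : (-(P * V * A - Q * U) : K) = C * Q' := by exact_mod_cast hV
    have n1' : (U ^ 2 + A * B * V ^ 2 : K) = C := by exact_mod_cast n1
    have e1 : (C : K) * ((U + V * (r * s)) * (P' * r + Q' * s))
      = (U + V * (r * s)) * (C * P' * r + C * Q' * s) := by ring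
    rw [e1, ← hU', ← hV', ← n1']
    rw [← hr, show (B : K) = - s ^ 2 by rw [hs]; ring]
    ring
end
lemma unitO {a b c : ℕ} {A B ρ P Q : ℤ} (ha : 2 ≤ a) (hb : 2 ≤ b) (hA : 0 < A) (hB : 0 < B)
    (h : OG a b c A B ρ P Q 0) : False := by
  obtain ⟨p, hp, hpa⟩ := Nat.exists_prime_and_dvd (show a ≠ 1 by omega)
  obtain ⟨q, hq, hqb⟩ := Nat.exists_prime_and_dvd (show b ≠ 1 by omega)
  have h1 : (p : ℤ) ∣ A * P ^ 2 := by
    rw [pow_two, ← mul_assoc]; exact Dvd.dvd.mul_right (h.radA p hp hpa) _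
  have h2 : (q : ℤ) ∣ B * Q ^ 2 := by
    rw [pow_two, ← mul_assoc]; exact Dvd.dvd.mul_right (h.radB q hq hqb) _
  have hn := h.norm
  simp only [pow_zero] at hn
  have p1 : 0 ≤ A * P ^ 2 := by positivity
  have p2 : 0 ≤ B * Q ^ 2 := by positivity
  have := hp.two_le
  have := hq.two_le
  rcases (show A * P ^ 2 = 1 ∨ B * Q ^ 2 = 1 by omega) with h3 | h3
  · rw [h3] at h1
    have := Int.le_of_dvd (by norm_num) h1
    omega
  · rw [h3] at h2
    have := Int.le_of_dvd (by norm_num) h2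
    omega

lemma unitE {a b c : ℕ} {A B ρ U V : ℤ} (ha : 2 ≤ a) (hA : 0 < A) (hB : 0 < B)
    (h : EG a b c A B ρ U V 0) : V = 0 ∧ ∃ ε : ℤˣ, U = ε := by
  obtain ⟨p, hp, hpa⟩ := Nat.exists_prime_and_dvd (show a ≠ 1 by omega)
  have h1 : (p : ℤ) ∣ A * B * V ^ 2 := by
    rw [pow_two, ← mul_assoc]; exact Dvd.dvd.mul_right (h.radA p hp hpa) _
  have hn := h.norm
  simp only [pow_zero] at hn
  have p1 : 0 ≤ U ^ 2 := by positivity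
  have p2 : 0 ≤ A * B * V ^ 2 := by positivity
  have := hp.two_le
  have h0 : A * B * V ^ 2 = 0 := by
    by_contra h0
    have h3 : A * B * V ^ 2 = 1 := by omega
    rw [h3] at h1
    have := Int.le_of_dvd (by norm_num) h1
    omega
  have hV : V = 0 := by
    have : A * B ≠ 0 := by positivity
    simpa [this, hA.ne', hB.ne'] using h0
  refine ⟨hV, ?_⟩
  rw [h0, add_zero] at hn
  rw [pow_two] at hn
  rcases mul_self_eq_one_iff.mp hn with h | h
  · exact ⟨1, by simpa using h⟩
  · exact ⟨-1, by simpa using h⟩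

lemma euclid {a b c : ℕ} {A B ρ : ℤ} {N : ℕ} (ha : 2 ≤ a) (hb : 2 ≤ b)
    (hA : 0 < A) (hB : 0 < B) (hc : 0 < c) (hac : a.Coprime c) (hbc : b.Coprime c)
    (hρ : (c : ℤ) ^ N ∣ A * ρ ^ 2 + B) {K : Type*} [Field K] [CharZero K] {r s : K}
    (hr : r ^ 2 = A) (hs : s ^ 2 = -B) (n : ℕ) :
    (∀ (P₁ Q₁ P₂ Q₂ : ℤ) (z₁ z₂ : ℕ), OG a b c A B ρ P₁ Q₁ z₁ → OG a b c A B ρ P₂ Q₂ z₂ →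
      z₁ ≤ N → z₂ ≤ N → z₁ + z₂ ≤ n →
      ∃ (P Q : ℤ) (z m₁ m₂ : ℕ) (ε₁ ε₂ : ℤˣ), OG a b c A B ρ P Q z ∧
        (P₁ * r + Q₁ * s : K) = (ε₁ : ℤ) * (P * r + Q * s) ^ (2 * m₁ + 1) ∧
        (P₂ * r + Q₂ * s : K) = (ε₂ : ℤ) * (P * r + Q * s) ^ (2 * m₂ + 1)) ∧
    (∀ (P₁ Q₁ U V : ℤ) (z₁ z₂ : ℕ), OG a b c A B ρ P₁ Q₁ z₁ → EG a b c A B ρ U V z₂ → 0 < z₂ →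
      z₁ ≤ N → z₂ ≤ N → z₁ + z₂ ≤ n →
      ∃ (P Q : ℤ) (z m₁ m₂ : ℕ) (ε₁ ε₂ : ℤˣ), OG a b c A B ρ P Q z ∧
        (P₁ * r + Q₁ * s : K) = (ε₁ : ℤ) * (P * r + Q * s) ^ (2 * m₁ + 1) ∧
        (U + V * (r * s) : K) = (ε₂ : ℤ) * (P * r + Q * s) ^ (2 * m₂)) := by
  have pos : ∀ {P Q : ℤ} {z : ℕ}, OG a b c A B ρ P Q z → 0 < z := by
    intro P Q z h
    rcases Nat.eq_zero_or_pos z with h0 | h0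
    · subst h0; exact (unitO ha hb hA hB h).elim
    · exact h0
  induction n with
  | zero =>
    refine ⟨?_, ?_⟩
    · intro P₁ Q₁ P₂ Q₂ z₁ z₂ h1 h2 _ _ h
      have := pos h1; omega
    · intro P₁ Q₁ P₂ Q₂ z₁ z₂ h1 h2 _ _ _ h
      have := pos h1; omega
  | succ n ih =>
    obtain ⟨ih1, ih2⟩ := ih
    have key : ∀ (P₁ Q₁ P₂ Q₂ : ℤ) (z₁ z₂ : ℕ), OG a b c A B ρ P₁ Q₁ z₁ →
      OG a b c A B ρ P₂ Q₂ z₂ → z₁ ≤ N → z₂ ≤ N → z₁ + z₂ ≤ n + 1 → z₁ ≤ z₂ →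
      ∃ (P Q : ℤ) (z m₁ m₂ : ℕ) (ε₁ ε₂ : ℤˣ), OG a b c A B ρ P Q z ∧
        (P₁ * r + Q₁ * s : K) = (ε₁ : ℤ) * (P * r + Q * s) ^ (2 * m₁ + 1) ∧
        (P₂ * r + Q₂ * s : K) = (ε₂ : ℤ) * (P * r + Q * s) ^ (2 * m₂ + 1) := by
      intro P₁ Q₁ P₂ Q₂ z₁ z₂ h1 h2 hN1 hN2 hn hle
      have hz1 := pos h1
      obtain ⟨U, V, hE, heq⟩ := div_OO hc hac hbc hρ hr hs h1 h2 hle hN2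
      rcases Nat.eq_or_lt_of_le hle with h | h
      · subst h
        rw [Nat.sub_self] at hE
        obtain ⟨hV, ε, hU⟩ := unitE ha hA hB hE
        refine ⟨P₁, Q₁, z₁, 0, 0, 1, ε, h1, by simp, ?_⟩
        rw [heq, hV, hU]
        push_cast
        ring
      · obtain ⟨P, Q, z, m₁, m₂, ε₁, ε₂, hO, e1, e2⟩ :=
          ih2 P₁ Q₁ U V z₁ (z₂ - z₁) h1 hE (by omega) hN1 (by omega) (by omega)
        refine ⟨P, Q, z, m₁, m₁ + m₂, ε₁, ε₁ * ε₂, hO, e1, ?_⟩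
        rw [heq, e1, e2]
        push_cast
        ring
    refine ⟨?_, ?_⟩
    · intro P₁ Q₁ P₂ Q₂ z₁ z₂ h1 h2 hN1 hN2 hn
      rcases le_total z₁ z₂ with h | h
      · exact key P₁ Q₁ P₂ Q₂ z₁ z₂ h1 h2 hN1 hN2 hn h
      · obtain ⟨P, Q, z, m₁, m₂, ε₁, ε₂, hO, e1, e2⟩ :=
          key P₂ Q₂ P₁ Q₁ z₂ z₁ h2 h1 hN2 hN1 (by omega) h
        exact ⟨P, Q, z, m₂, m₁, ε₂, ε₁, hO, e2, e1⟩
    · intro P₁ Q₁ U V z₁ z₂ h1 h2 hz2 hN1 hN2 hn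
      have hz1 := pos h1
      rcases lt_or_ge z₁ z₂ with h | h
      · obtain ⟨P', Q', hO', heq⟩ := div_OE hc hac hbc hρ hr hs h1 h2 h.le hN2
        obtain ⟨P, Q, z, m₁, m₂, ε₁, ε₂, hO, e1, e2⟩ :=
          ih1 P₁ Q₁ P' Q' z₁ (z₂ - z₁) h1 hO' hN1 (by omega) (by omega)
        refine ⟨P, Q, z, m₁, m₁ + m₂ + 1, ε₁, ε₁ * ε₂, hO, e1, ?_⟩
        rw [heq, e1, e2]
        push_cast
        ring
      · obtain ⟨P', Q', hO', heq⟩ := div_EO hc hac hbc hρ hr hs h2 h1 h hN1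
        obtain ⟨P, Q, z, m₁, m₂, ε₁, ε₂, hO, e1, e2⟩ :=
          ih2 P' Q' U V (z₁ - z₂) z₂ hO' h2 hz2 (by omega) hN2 (by omega)
        refine ⟨P, Q, z, m₁ + m₂, m₂, ε₁ * ε₂, ε₂, hO, ?_, e2⟩
        rw [heq, e1, e2]
        push_cast
        ring

lemma pow_RS {K : Type*} [CommRing K] {A B : ℤ} {r s : K} (hr : r ^ 2 = A) (hs : s ^ 2 = -B)
    (P Q : ℤ) (k : ℕ) :
    (P * r + Q * s : K) ^ (2 * k + 1) =
      ((P * (RS (A * P ^ 2) (B * Q ^ 2) k).1 : ℤ) : K) * r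
      + ((Q * (RS (A * P ^ 2) (B * Q ^ 2) k).2 : ℤ) : K) * s := by
  induction k with
  | zero => simp [RS]
  | succ k ih =>
    have : (P * r + Q * s : K) ^ (2 * (k + 1) + 1)
      = (P * r + Q * s : K) ^ (2 * k + 1) * (P * r + Q * s : K) ^ 2 := by ring
    rw [this, ih]
    simp only [RS]
    push_cast
    rw [← hr, show (B : K) = - s ^ 2 by rw [hs]; ring]
    ring

open Complex in
lemma coeff_eq {A B : ℤ} (hA : 0 < A) (hB : 0 < B) {P Q P' Q' : ℤ}
    (h : (P * (Real.sqrt A : ℂ) + Q * (I * (Real.sqrt B : ℂ)) : ℂ)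
      = P' * (Real.sqrt A : ℂ) + Q' * (I * (Real.sqrt B : ℂ))) : P = P' ∧ Q = Q' := by
  have hA' : Real.sqrt A ≠ 0 := (Real.sqrt_pos.mpr (by exact_mod_cast hA)).ne'
  have hB' : Real.sqrt B ≠ 0 := (Real.sqrt_pos.mpr (by exact_mod_cast hB)).ne'
  have hre := congrArg Complex.re h
  have him := congrArg Complex.im h
  simp at hre him
  constructor
  · rcases hre with h | h
    · exact h
    · exact absurd h hA'
  · rcases him with h | h
    · exact h
    · exact absurd h hB'
/-- The exceptional solution. -/
def Exc (a b c x y : ℕ) : Prop :=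
  (a = 10 ∧ b = 3 ∧ c = 13 ∧ x = 1 ∧ y = 7) ∨ (a = 3 ∧ b = 10 ∧ c = 13 ∧ x = 7 ∧ y = 1)

lemma unit_sq (ε : ℤˣ) : ((ε : ℤ)) ^ 2 = 1 := by
  rcases Int.units_eq_one_or ε with h | h <;> simp [h]

open Complex in
lemma coeff_eq_mul {A B : ℤ} (hA : 0 < A) (hB : 0 < B) {P Q P' Q' ε : ℤ}
    (h : (P * (Real.sqrt A : ℂ) + Q * (I * (Real.sqrt B : ℂ)) : ℂ)
      = ε * (P' * (Real.sqrt A : ℂ) + Q' * (I * (Real.sqrt B : ℂ)))) :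
    P = ε * P' ∧ Q = ε * Q' := by
  apply coeff_eq hA hB
  rw [h]
  push_cast
  ring

open Complex in
lemma one_side (a b c : ℕ) (ha : 2 ≤ a) (hb : 2 ≤ b) (hab : a.Coprime b) (x y : ℕ)
    {A B ρ : ℤ} (hA : A = (a : ℤ) ^ (x % 2)) (hB : B = (b : ℤ) ^ (y % 2)) (σ ε : ℤˣ)
    {P Q : ℤ} {z m : ℕ} (hO : OG a b c A B ρ P Q z) (hm : 1 ≤ m)
    (h : (((σ * (a : ℤ) ^ (x / 2) : ℤ) : ℂ) * (Real.sqrt A : ℂ)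
      + (((b : ℤ) ^ (y / 2) : ℤ) : ℂ) * (I * (Real.sqrt B : ℂ)) : ℂ)
      = ((ε : ℤ) : ℂ) * (P * (Real.sqrt A : ℂ) + Q * (I * (Real.sqrt B : ℂ))) ^ (2 * m + 1)) :
    Exc a b c x y := by
  have hA0 : 0 < A := by rw [hA]; positivity
  have hB0 : 0 < B := by rw [hB]; positivity
  have hr : (Real.sqrt A : ℂ) ^ 2 = (A : ℂ) := by
    rw [← Complex.ofReal_pow, Real.sq_sqrt (by exact_mod_cast hA0.le)]; simp
  have hs : (I * (Real.sqrt B : ℂ)) ^ 2 = -(B : ℂ) := by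
    rw [mul_pow, ← Complex.ofReal_pow, Real.sq_sqrt (by exact_mod_cast hB0.le)]; simp
  obtain ⟨q, hq, t, ht⟩ := Nat.exists_prime_and_dvd (show 2 * m + 1 ≠ 1 by omega)
  have hqo : q % 2 = 1 := by
    rcases Nat.mod_two_eq_zero_or_one q with h | h
    · exfalso
      have := congrArg (· % 2) ht
      simp [Nat.mul_mod, h] at this
    · exact h
  have hto : t % 2 = 1 := by
    rcases Nat.mod_two_eq_zero_or_one t with h | h
    · exfalso
      have := congrArg (· % 2) ht
      simp [Nat.mul_mod, h] at this
    · exact h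
  have hq2 := hq.two_le
  obtain ⟨k, rfl⟩ : ∃ k, q = 2 * k + 3 := ⟨(q - 3) / 2, by omega⟩
  obtain ⟨l, rfl⟩ : ∃ l, t = 2 * l + 1 := ⟨t / 2, by omega⟩
  rw [ht, mul_comm (2 * k + 3) (2 * l + 1), pow_mul, pow_RS hr hs, show 2 * k + 3 = 2 * (k + 1) + 1 by ring,
    pow_RS hr hs] at h
  set P' := P * (RS (A * P ^ 2) (B * Q ^ 2) l).1 with hP'
  set Q' := Q * (RS (A * P ^ 2) (B * Q ^ 2) l).2 with hQ'
  obtain ⟨h1, h2⟩ := coeff_eq_mul hA0 hB0 h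
  have hmodx := Nat.mod_add_div x 2
  have hmody := Nat.mod_add_div y 2
  refine endgame a b c ha hb hab (x % 2) (y % 2) (z * (2 * l + 1)) x y k (by omega) (by omega)
    P' Q' (A * P' ^ 2) (B * Q' ^ 2) (by rw [hA]) (by rw [hB]) ?_ ?_ ?_ hq ?_ ?_
  · intro p hp hpa
    rw [← hA, hP', ← mul_assoc]
    exact Dvd.dvd.mul_right (hO.radA p hp hpa) _
  · intro p hp hpa
    rw [← hB, hQ', ← mul_assoc]
    exact Dvd.dvd.mul_right (hO.radB p hp hpa) _
  · rw [pow_mul, ← hO.norm, ← RS_norm, hP', hQ']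
    ring
  · have e1 := congrArg (fun u : ℤ => u ^ 2) h1
    simp only [mul_pow, unit_sq, one_mul] at e1
    calc _ = A * (P' ^ 2 * (RS (A * P' ^ 2) (B * Q' ^ 2) (k + 1)).1 ^ 2) := by ring
      _ = A * ((a : ℤ) ^ (x / 2)) ^ 2 := by rw [← e1]
      _ = (a : ℤ) ^ (x % 2 + 2 * (x / 2)) := by rw [hA]; ring
      _ = _ := by rw [hmodx]
  · have e1 := congrArg (fun u : ℤ => u ^ 2) h2
    simp only [mul_pow, unit_sq, one_mul] at e1
    calc _ = B * (Q' ^ 2 * (RS (A * P' ^ 2) (B * Q' ^ 2) (k + 1)).2 ^ 2) := by ring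
      _ = B * ((b : ℤ) ^ (y / 2)) ^ 2 := by rw [← e1]
      _ = (b : ℤ) ^ (y % 2 + 2 * (y / 2)) := by rw [hB]; ring
      _ = _ := by rw [hmody]

lemma sol_OG (a b c x y z : ℕ) (hx : 0 < x) (hy : 0 < y) (h : a ^ x + b ^ y = c ^ z) (σ : ℤˣ)
    (ρ : ℤ) (hφ : (c : ℤ) ^ z ∣ σ * (a : ℤ) ^ (x / 2) + (b : ℤ) ^ (y / 2) * ρ) :
    OG a b c ((a : ℤ) ^ (x % 2)) ((b : ℤ) ^ (y % 2)) ρ (σ * (a : ℤ) ^ (x / 2))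
      ((b : ℤ) ^ (y / 2)) z := by
  have hmodx := Nat.mod_add_div x 2
  have hmody := Nat.mod_add_div y 2
  refine ⟨?_, hφ, ?_, ?_⟩
  · have : ((a ^ x + b ^ y : ℕ) : ℤ) = ((c ^ z : ℕ) : ℤ) := by rw [h]
    push_cast at this
    rw [← this, mul_pow, unit_sq]
    conv_rhs => rw [← hmodx, ← hmody]
    ring
  · intro p hp hpa
    have : (a : ℤ) ^ (x % 2) * (σ * (a : ℤ) ^ (x / 2)) = σ * (a : ℤ) ^ (x % 2 + x / 2) := by ring
    rw [this]
    apply Dvd.dvd.mul_left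
    have hpa' : (p : ℤ) ∣ (a : ℤ) := by exact_mod_cast hpa
    exact dvd_trans hpa' (dvd_pow_self _ (by omega))
  · intro p hp hpa
    rw [← pow_add]
    have hpa' : (p : ℤ) ∣ (b : ℤ) := by exact_mod_cast hpa
    exact dvd_trans hpa' (dvd_pow_self _ (by omega))

open Complex in
lemma pair_aux (a b c : ℕ) (ha : 2 ≤ a) (hb : 2 ≤ b) (hc : 0 < c) (hab : a.Coprime b)
    (hac : a.Coprime c) (hbc : b.Coprime c) (x₁ y₁ z₁ x₂ y₂ z₂ : ℕ)
    (hx₁ : 0 < x₁) (hy₁ : 0 < y₁) (hx₂ : 0 < x₂) (hy₂ : 0 < y₂)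
    (h₁ : a ^ x₁ + b ^ y₁ = c ^ z₁) (h₂ : a ^ x₂ + b ^ y₂ = c ^ z₂)
    (hx : x₁ % 2 = x₂ % 2) (hy : y₁ % 2 = y₂ % 2) (σ : ℤˣ) (hz : z₁ ≤ z₂)
    (h : (c : ℤ) ^ z₁ ∣ (a : ℤ) ^ (x₁ / 2) * (b : ℤ) ^ (y₂ / 2)
      - σ * (a : ℤ) ^ (x₂ / 2) * (b : ℤ) ^ (y₁ / 2)) :
    (x₁ = x₂ ∧ y₁ = y₂) ∨ Exc a b c x₁ y₁ ∨ Exc a b c x₂ y₂ := by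
  have hcop : IsCoprime ((b : ℤ) ^ (y₂ / 2)) ((c : ℤ) ^ z₂) :=
    (Nat.isCoprime_iff_coprime.mpr hbc).pow
  obtain ⟨u, v, huv⟩ := hcop
  set ρ : ℤ := -(σ * (a : ℤ) ^ (x₂ / 2)) * u with hρ
  have O2 := sol_OG a b c x₂ y₂ z₂ hx₂ hy₂ h₂ σ ρ
    ⟨σ * (a : ℤ) ^ (x₂ / 2) * v, by rw [hρ]; linear_combination (-σ * (a : ℤ) ^ (x₂ / 2)) * huv⟩
  have O1 := sol_OG a b c x₁ y₁ z₁ hx₁ hy₁ h₁ 1 ρ (by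
    obtain ⟨w, hw⟩ := h
    have hs : (c : ℤ) ^ z₂ = (c : ℤ) ^ z₁ * (c : ℤ) ^ (z₂ - z₁) := by
      rw [← pow_add]; congr 1; omega
    refine ⟨u * w + (a : ℤ) ^ (x₁ / 2) * v * (c : ℤ) ^ (z₂ - z₁), ?_⟩
    rw [hs] at huv
    rw [hρ]; push_cast
    linear_combination (-(a : ℤ) ^ (x₁ / 2)) * huv + u * hw)
  rw [hx, hy] at O1
  set A : ℤ := (a : ℤ) ^ (x₂ % 2) with hA
  set B : ℤ := (b : ℤ) ^ (y₂ % 2) with hB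
  have hρ' : (c : ℤ) ^ z₂ ∣ A * ρ ^ 2 + B := by
    have hn := O2.norm
    refine ⟨u ^ 2 + B * (2 * u * (b : ℤ) ^ (y₂ / 2) * v + v ^ 2 * (c : ℤ) ^ z₂), ?_⟩
    rw [hρ]
    linear_combination u ^ 2 * hn - B * (u * (b : ℤ) ^ (y₂ / 2) + v * (c : ℤ) ^ z₂ + 1) * huv
  have hA0 : 0 < A := by rw [hA]; positivity
  have hB0 : 0 < B := by rw [hB]; positivity
  have hr : (Real.sqrt A : ℂ) ^ 2 = (A : ℂ) := by
    rw [← Complex.ofReal_pow, Real.sq_sqrt (by exact_mod_cast hA0.le)]; simp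
  have hs : (I * (Real.sqrt B : ℂ)) ^ 2 = -(B : ℂ) := by
    rw [mul_pow, ← Complex.ofReal_pow, Real.sq_sqrt (by exact_mod_cast hB0.le)]; simp
  obtain ⟨P, Q, z, m₁, m₂, ε₁, ε₂, hO, e1, e2⟩ :=
    (euclid ha hb hA0 hB0 hc hac hbc hρ' hr hs (z₁ + z₂)).1 _ _ _ _ z₁ z₂ O1 O2 hz le_rfl le_rfl
  rcases Nat.eq_zero_or_pos m₁ with hm1 | hm1
  · rcases Nat.eq_zero_or_pos m₂ with hm2 | hm2
    · left
      subst hm1 hm2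
      simp only [mul_zero, zero_add, pow_one] at e1 e2
      obtain ⟨f1, f2⟩ := coeff_eq_mul hA0 hB0 e1
      obtain ⟨f3, f4⟩ := coeff_eq_mul hA0 hB0 e2
      have g1 := congrArg (fun u : ℤ => u ^ 2) f1
      have g2 := congrArg (fun u : ℤ => u ^ 2) f2
      have g3 := congrArg (fun u : ℤ => u ^ 2) f3
      have g4 := congrArg (fun u : ℤ => u ^ 2) f4
      simp only [mul_pow, unit_sq, one_mul] at g1 g2 g3 g4
      have k1 : (((a ^ (x₁ / 2)) ^ 2 : ℕ) : ℤ) = ((a ^ (x₂ / 2)) ^ 2 : ℕ) := by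
        push_cast; rw [g1, g3]
      have k2 : (((b ^ (y₁ / 2)) ^ 2 : ℕ) : ℤ) = ((b ^ (y₂ / 2)) ^ 2 : ℕ) := by
        push_cast; rw [g2, g4]
      have k1' := Nat.pow_right_injective ha (Nat.pow_left_injective two_ne_zero (Int.natCast_inj.mp k1))
      have k2' := Nat.pow_right_injective hb (Nat.pow_left_injective two_ne_zero (Int.natCast_inj.mp k2))
      omega
    · right; right
      exact one_side a b c ha hb hab x₂ y₂ hA hB σ ε₂ hO hm2 e2
  · right; left
    exact one_side a b c ha hb hab x₁ y₁ (by rw [hA, hx]) (by rw [hB, hy]) 1 ε₁ hO hm1 e1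

lemma pair (a b c : ℕ) (ha : 2 ≤ a) (hb : 2 ≤ b) (hc : 0 < c) (hab : a.Coprime b)
    (hac : a.Coprime c) (hbc : b.Coprime c) (x₁ y₁ z₁ x₂ y₂ z₂ : ℕ)
    (hx₁ : 0 < x₁) (hy₁ : 0 < y₁) (hx₂ : 0 < x₂) (hy₂ : 0 < y₂)
    (h₁ : a ^ x₁ + b ^ y₁ = c ^ z₁) (h₂ : a ^ x₂ + b ^ y₂ = c ^ z₂)
    (hx : x₁ % 2 = x₂ % 2) (hy : y₁ % 2 = y₂ % 2) (σ : ℤˣ)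
    (h : (c : ℤ) ^ (min z₁ z₂) ∣ (a : ℤ) ^ (x₁ / 2) * (b : ℤ) ^ (y₂ / 2)
      - σ * (a : ℤ) ^ (x₂ / 2) * (b : ℤ) ^ (y₁ / 2)) :
    (x₁ = x₂ ∧ y₁ = y₂) ∨ Exc a b c x₁ y₁ ∨ Exc a b c x₂ y₂ := by
  rcases le_total z₁ z₂ with hz | hz
  · rw [min_eq_left hz] at h
    exact pair_aux a b c ha hb hc hab hac hbc x₁ y₁ z₁ x₂ y₂ z₂ hx₁ hy₁ hx₂ hy₂ h₁ h₂ hx hy σ hz h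
  · rw [min_eq_right hz] at h
    have := pair_aux a b c ha hb hc hab hac hbc x₂ y₂ z₂ x₁ y₁ z₁ hx₂ hy₂ hx₁ hy₁ h₂ h₁ hx.symm
      hy.symm σ hz (by
        obtain ⟨w, hw⟩ := h
        refine ⟨-σ * w, ?_⟩
        have := unit_sq σ
        linear_combination (-σ : ℤ) * hw - (a : ℤ) ^ (x₂ / 2) * (b : ℤ) ^ (y₁ / 2) * this)
    tauto
lemma group_aux {G : Type*} [CommGroup G] (a b w : G) (hw : w ^ 2 = 1) (x y : ℕ)
    (h : a ^ x = w * b ^ y) (m n k l : ℤ) (hm : Odd m) (hn : Even n) (hk : Even k) (hl : Odd l)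
    (h1 : a ^ m = b ^ n) (h2 : a ^ k = b ^ l) : w = 1 := by
  obtain ⟨i, hi⟩ : Odd (m * l - n * k) := (hm.mul hl).sub_even (hn.mul_right k)
  set e := m * l - n * k with he
  have ha : a ^ e = 1 := by
    rw [he, zpow_sub, mul_comm n k, zpow_mul, zpow_mul, h1, h2, ← zpow_mul, ← zpow_mul, mul_comm n l]
    simp
  have hb : b ^ e = 1 := by
    rw [he, zpow_sub, mul_comm m l, zpow_mul, zpow_mul, ← h1, ← h2, ← zpow_mul, ← zpow_mul,
      mul_comm k m]
    simp
  have h3 : (a ^ x) ^ e = (w * b ^ y) ^ e := by rw [h]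
  rw [mul_zpow] at h3
  have e1 : (a ^ x) ^ e = 1 := by
    rw [← zpow_natCast, ← zpow_mul, mul_comm, zpow_mul, ha, one_zpow]
  have e2 : (b ^ y) ^ e = 1 := by
    rw [← zpow_natCast, ← zpow_mul, mul_comm, zpow_mul, hb, one_zpow]
  rw [e1, e2, mul_one, hi, zpow_add, zpow_mul] at h3
  have : w ^ (2 : ℤ) = 1 := by exact_mod_cast hw
  rw [this] at h3
  simpa using h3.symm

lemma two_classes {p : ℕ} [Fact p.Prime] (hp : p ≠ 2) (a b : (ZMod p)ˣ)
    (x₁ y₁ x₂ y₂ x₃ y₃ x₄ y₄ : ℕ)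
    (h₁ : a ^ x₁ = -1 * b ^ y₁) (h₂ : a ^ x₂ = -1 * b ^ y₂)
    (h₃ : a ^ x₃ = -1 * b ^ y₃) (h₄ : a ^ x₄ = -1 * b ^ y₄)
    (c1 : y₁ % 2 = y₂ % 2) (c2 : x₁ % 2 ≠ x₂ % 2)
    (c3 : x₃ % 2 = x₄ % 2) (c4 : y₃ % 2 ≠ y₄ % 2) : False := by
  have key : (-1 : (ZMod p)ˣ) = 1 := by
    apply group_aux a b (-1) (by simp) x₁ y₁ h₁ ((x₁ : ℤ) - x₂) ((y₁ : ℤ) - y₂)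
      ((x₃ : ℤ) - x₄) ((y₃ : ℤ) - y₄)
    · rw [Int.odd_iff]; omega
    · rw [Int.even_iff]; omega
    · rw [Int.even_iff]; omega
    · rw [Int.odd_iff]; omega
    · rw [zpow_sub, zpow_sub]; simp only [zpow_natCast]; rw [h₁, h₂]; simp
    · rw [zpow_sub, zpow_sub]; simp only [zpow_natCast]; rw [h₃, h₄]; simp
  have := congrArg (fun u : (ZMod p)ˣ => (u : ZMod p)) key
  simp only [Units.val_neg, Units.val_one] at this
  have h2 : 2 < p := lt_of_le_of_ne (Nat.Prime.two_le Fact.out) (Ne.symm hp)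
  have : Fact (2 < p) := ⟨h2⟩
  exact ZMod.neg_one_ne_one (by assumption)

/-- A choice of sign for residues. -/
def sg (p : ℕ) (u : ZMod p) : Bool := decide (2 * u.val < p)

lemma sg_neg {p : ℕ} [Fact p.Prime] (hp : p ≠ 2) (u : ZMod p) (hu : u ≠ 0) :
    sg p (-u) ≠ sg p u := by
  have hpr : p.Prime := Fact.out
  have : NeZero u := ⟨hu⟩
  have h1 := ZMod.val_neg_of_ne_zero u
  have h2 := ZMod.val_lt u
  have h3 := hpr.eq_two_or_odd
  intro h
  unfold sg at h
  rw [decide_eq_decide, h1] at h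
  omega

/-- Nat solution relation. -/
def IsSol (a b c : ℕ) (s : ℕ × ℕ × ℕ) : Prop :=
  0 < s.1 ∧ 0 < s.2.1 ∧ 0 < s.2.2 ∧ a ^ s.1 + b ^ s.2.1 = c ^ s.2.2

/-- the residue attached to a solution -/
def ures (a b : ℕ) (p : ℕ) (s : ℕ × ℕ × ℕ) : ZMod p :=
  (a : ZMod p) ^ (s.1 / 2) * ((b : ZMod p) ^ (s.2.1 / 2))⁻¹

lemma sol_mod {a b c : ℕ} {s : ℕ × ℕ × ℕ} (hs : IsSol a b c s) {p : ℕ} (hpc : p ∣ c) :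
    (a : ZMod p) ^ s.1 + (b : ZMod p) ^ s.2.1 = 0 := by
  have h : ((c ^ s.2.2 : ℕ) : ZMod p) = 0 :=
    (ZMod.natCast_eq_zero_iff _ _).mpr (dvd_pow hpc hs.2.2.1.ne')
  rw [← hs.2.2.2] at h
  exact_mod_cast h

lemma natCast_ne {a c : ℕ} (hac : a.Coprime c) {p : ℕ} (hp : p.Prime) (hpc : p ∣ c) :
    (a : ZMod p) ≠ 0 := by
  rw [Ne, ZMod.natCast_eq_zero_iff]
  intro h
  exact hp.one_lt.ne' (Nat.eq_one_of_dvd_coprimes hac h hpc)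

lemma compat {a b c : ℕ} (hac : a.Coprime c) (hbc : b.Coprime c) {s t : ℕ × ℕ × ℕ}
    (hs : IsSol a b c s) (ht : IsSol a b c t) (hx : s.1 % 2 = t.1 % 2)
    (hy : s.2.1 % 2 = t.2.1 % 2) {p : ℕ} (hp : p.Prime) (hpc : p ∣ c) :
    ures a b p s = ures a b p t ∨ ures a b p s = -ures a b p t := by
  have : Fact p.Prime := ⟨hp⟩
  have ha := natCast_ne hac hp hpc
  have hb := natCast_ne hbc hp hpc
  rw [← sq_eq_sq_iff_eq_or_eq_neg]
  have key : ∀ r : ℕ × ℕ × ℕ, IsSol a b c r →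
      (a : ZMod p) ^ (r.1 % 2) * (ures a b p r) ^ 2 = -(b : ZMod p) ^ (r.2.1 % 2) := by
    intro r hr
    have h := sol_mod hr hpc
    rw [← Nat.mod_add_div r.1 2, ← Nat.mod_add_div r.2.1 2] at h
    unfold ures
    have hb' : (b : ZMod p) ^ (r.2.1 / 2) ≠ 0 := pow_ne_zero _ hb
    field_simp
    rw [pow_add, pow_add, pow_mul', pow_mul'] at h
    linear_combination h
  have h1 := key s hs
  have h2 := key t ht
  rw [← hx, ← hy, ← h1] at h2
  exact (mul_left_cancel₀ (pow_ne_zero _ ha) h2).symm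

lemma lift_dvd {c : ℕ} (n : ℕ) (X Y Z : ℤ) (hZ : IsCoprime (c : ℤ) Z)
    (h : (c : ℤ) ^ n ∣ Z * (X ^ 2 - Y ^ 2))
    (hp : ∀ p : ℕ, p.Prime → p ∣ c → (p : ℤ) ∣ X - Y ∧ ¬ (p : ℤ) ∣ X + Y) :
    (c : ℤ) ^ n ∣ X - Y := by
  have h1 : (c : ℤ) ^ n ∣ X ^ 2 - Y ^ 2 := (hZ.pow_left).dvd_of_dvd_mul_left h
  rw [sq_sub_sq] at h1
  have h2 : IsCoprime (c : ℤ) (X + Y) := by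
    rw [Int.isCoprime_iff_gcd_eq_one]
    by_contra hg
    obtain ⟨p, hp1, hp2⟩ := Nat.exists_prime_and_dvd hg
    have h3 : (p : ℤ) ∣ (c : ℤ) := (Int.natCast_dvd_natCast.mpr hp2).trans (Int.gcd_dvd_left ..)
    have h4 : (p : ℤ) ∣ X + Y := (Int.natCast_dvd_natCast.mpr hp2).trans (Int.gcd_dvd_right ..)
    exact (hp p hp1 (by exact_mod_cast h3)).2 h4
  exact (h2.pow_left).dvd_of_dvd_mul_left h1

lemma same_of_sign {a b c : ℕ} (ha : 2 ≤ a) (hb : 2 ≤ b) (hc : 0 < c) (hodd : Odd c)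
    (hab : a.Coprime b)
    (hac : a.Coprime c) (hbc : b.Coprime c) {s t : ℕ × ℕ × ℕ}
    (hs : IsSol a b c s) (ht : IsSol a b c t) (hx : s.1 % 2 = t.1 % 2)
    (hy : s.2.1 % 2 = t.2.1 % 2) (σ : ℤˣ)
    (h : ∀ p : ℕ, p.Prime → p ∣ c → ures a b p s = ((σ : ℤ) : ZMod p) * ures a b p t) :
    s = t ∨ Exc a b c s.1 s.2.1 ∨ Exc a b c t.1 t.2.1 := by
  obtain ⟨x₁, y₁, z₁⟩ := s
  obtain ⟨x₂, y₂, z₂⟩ := t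
  have hs' := hs
  have ht' := ht
  obtain ⟨hx₁, hy₁, hz₁, h₁⟩ := hs'
  obtain ⟨hx₂, hy₂, hz₂, h₂⟩ := ht'
  simp only at *
  have hac' : IsCoprime (c : ℤ) (a : ℤ) := Nat.isCoprime_iff_coprime.mpr hac.symm
  have hbc' : IsCoprime (c : ℤ) (b : ℤ) := Nat.isCoprime_iff_coprime.mpr hbc.symm
  have key : (c : ℤ) ^ (min z₁ z₂) ∣ (a : ℤ) ^ (x₁ / 2) * (b : ℤ) ^ (y₂ / 2)
      - σ * (a : ℤ) ^ (x₂ / 2) * (b : ℤ) ^ (y₁ / 2) := by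
    apply lift_dvd _ _ _ ((a : ℤ) ^ (x₁ % 2) * (b : ℤ) ^ (y₁ % 2))
    · exact (hac'.pow_right).mul_right hbc'.pow_right
    · have e1 : (a : ℤ) ^ x₁ + (b : ℤ) ^ y₁ = (c : ℤ) ^ z₁ := by exact_mod_cast h₁
      have e2 : (a : ℤ) ^ x₂ + (b : ℤ) ^ y₂ = (c : ℤ) ^ z₂ := by exact_mod_cast h₂
      have d1 : (c : ℤ) ^ (min z₁ z₂) ∣ (c : ℤ) ^ z₁ := pow_dvd_pow _ (min_le_left _ _)
      have d2 : (c : ℤ) ^ (min z₁ z₂) ∣ (c : ℤ) ^ z₂ := pow_dvd_pow _ (min_le_right _ _)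
      have m1 : (a : ℤ) ^ x₁ = (a : ℤ) ^ (x₁ % 2) * ((a : ℤ) ^ (x₁ / 2)) ^ 2 := by
        conv_lhs => rw [← Nat.mod_add_div x₁ 2]
        rw [pow_add, pow_mul']
      have m2 : (a : ℤ) ^ x₂ = (a : ℤ) ^ (x₁ % 2) * ((a : ℤ) ^ (x₂ / 2)) ^ 2 := by
        conv_lhs => rw [← Nat.mod_add_div x₂ 2]
        rw [pow_add, pow_mul', hx]
      have m3 : (b : ℤ) ^ y₁ = (b : ℤ) ^ (y₁ % 2) * ((b : ℤ) ^ (y₁ / 2)) ^ 2 := by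
        conv_lhs => rw [← Nat.mod_add_div y₁ 2]
        rw [pow_add, pow_mul']
      have m4 : (b : ℤ) ^ y₂ = (b : ℤ) ^ (y₁ % 2) * ((b : ℤ) ^ (y₂ / 2)) ^ 2 := by
        conv_lhs => rw [← Nat.mod_add_div y₂ 2]
        rw [pow_add, pow_mul', hy]
      have e : (a : ℤ) ^ (x₁ % 2) * (b : ℤ) ^ (y₁ % 2) * (((a : ℤ) ^ (x₁ / 2) * (b : ℤ) ^ (y₂ / 2)) ^ 2
          - (σ * (a : ℤ) ^ (x₂ / 2) * (b : ℤ) ^ (y₁ / 2)) ^ 2) =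
          (c : ℤ) ^ z₁ * (b : ℤ) ^ y₂ - (c : ℤ) ^ z₂ * (b : ℤ) ^ y₁ := by
        rw [← e1, ← e2, mul_pow, mul_pow, mul_pow, unit_sq, m1, m2, m3, m4]
        ring
      rw [e]
      exact dvd_sub (d1.mul_right _) (d2.mul_right _)
    · intro p hp hpc
      have : Fact p.Prime := ⟨hp⟩
      have ha0 := natCast_ne hac hp hpc
      have hb0 := natCast_ne hbc hp hpc
      have hu := h p hp hpc
      have hp2 : p ≠ 2 := by
        rintro rfl
        exact (Nat.not_even_iff_odd.mpr hodd) (even_iff_two_dvd.mpr hpc)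
      unfold ures at hu
      simp only at hu
      have hb1 : (b : ZMod p) ^ (y₁ / 2) ≠ 0 := pow_ne_zero _ hb0
      have hb2 : (b : ZMod p) ^ (y₂ / 2) ≠ 0 := pow_ne_zero _ hb0
      have ha1 : (a : ZMod p) ^ (x₁ / 2) ≠ 0 := pow_ne_zero _ ha0
      field_simp at hu
      constructor
      · rw [← ZMod.intCast_zmod_eq_zero_iff_dvd]
        push_cast
        linear_combination hu
      · rw [← ZMod.intCast_zmod_eq_zero_iff_dvd]
        push_cast
        intro h0
        have h3 : (2 : ZMod p) * ((a : ZMod p) ^ (x₁ / 2) * (b : ZMod p) ^ (y₂ / 2)) = 0 := by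
          linear_combination h0 + hu
        have h4 : (2 : ZMod p) ≠ 0 := by
          intro h5
          have : ((2 : ℕ) : ZMod p) = 0 := by exact_mod_cast h5
          rw [ZMod.natCast_eq_zero_iff] at this
          exact hp2 ((Nat.prime_dvd_prime_iff_eq hp Nat.prime_two).mp this)
        exact mul_ne_zero h4 (mul_ne_zero ha1 hb2) h3
  rcases pair a b c ha hb hc hab hac hbc x₁ y₁ z₁ x₂ y₂ z₂ hx₁ hy₁ hx₂ hy₂ h₁ h₂ hx hy σ key with
    h | h
  · left
    obtain ⟨rfl, rfl⟩ := h
    rw [h₁] at h₂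
    have hc2 : 2 ≤ c := by
      rcases Nat.lt_or_ge c 2 with hlt | hge
      · exfalso
        have : c = 1 := by omega
        rw [this, one_pow] at h₁
        have := Nat.one_le_pow x₁ a (by omega)
        have := Nat.one_le_pow y₁ b (by omega)
        omega
      · exact hge
    have := Nat.pow_right_injective hc2 h₂
    rw [this]
  · right; exact h
lemma ncard_le_of_inj {α T : Type*} [Fintype T] (S : Set α) (f : α → T)
    (hf : ∀ s ∈ S, ∀ t ∈ S, f s = f t → s = t) : S.ncard ≤ Fintype.card T := by
  have := Set.ncard_le_ncard_of_injOn (s := S) (t := Set.univ) f (fun _ _ => Set.mem_univ _)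
    (fun s hs t ht h => hf s hs t ht h) Set.finite_univ
  rwa [Set.ncard_univ, Nat.card_eq_fintype_card] at this

lemma pow_mod_period (n k m x : ℕ) (h : n ^ k % m = 1 % m) : n ^ x % m = n ^ (x % k) % m := by
  conv_lhs => rw [← Nat.mod_add_div x k, pow_add, pow_mul, Nat.mul_mod, Nat.pow_mod (n ^ k), h,
    ← Nat.pow_mod, one_pow, ← Nat.mul_mod, mul_one]

lemma parity_decide : ∀ r : ℕ, r < 6 → ∀ t : ℕ, t < 6 → ∀ w : ℕ, w < 2 → (10 ^ r % 13 + 3 ^ t % 13) % 13 = 0 →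
    (10 ^ r % 7 + 3 ^ t % 7) % 7 = 13 ^ w % 7 % 7 →
    ((r = 1 ∧ (2 + 3 ^ (t % 2)) % 8 = 13 ^ w % 8 % 8) ∨ r % 2 = 0 ∨
      (0 + 3 ^ (t % 2)) % 8 = 13 ^ w % 8 % 8) → r % 2 = 1 ∧ t % 2 = 1 := by
  intro r hr t ht w hw
  interval_cases r <;> interval_cases t <;> interval_cases w <;> decide

lemma parity_exc (x y z : ℕ) (hz : 0 < z) (h : 10 ^ x + 3 ^ y = 13 ^ z) :
    x % 2 = 1 ∧ y % 2 = 1 := by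
  have h13 : (10 ^ x + 3 ^ y) % 13 = 0 := by
    rw [h]; exact Nat.mod_eq_zero_of_dvd (dvd_pow_self 13 hz.ne')
  have h7 : (10 ^ x + 3 ^ y) % 7 = 13 ^ z % 7 := by rw [h]
  have h8 : (10 ^ x + 3 ^ y) % 8 = 13 ^ z % 8 := by rw [h]
  rw [Nat.add_mod, pow_mod_period 10 6 13 x (by norm_num), pow_mod_period 3 6 13 y (by norm_num)]
    at h13
  rw [Nat.add_mod, pow_mod_period 10 6 7 x (by norm_num), pow_mod_period 3 6 7 y (by norm_num),
    pow_mod_period 13 2 7 z (by norm_num), ← Nat.mod_mod (13 ^ _)] at h7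
  rw [Nat.add_mod, pow_mod_period 3 2 8 y (by norm_num),
    pow_mod_period 13 2 8 z (by norm_num), ← Nat.mod_mod (13 ^ _)] at h8
  have := parity_decide (x % 6) (Nat.mod_lt _ (by norm_num)) (y % 6) (Nat.mod_lt _ (by norm_num))
    (z % 2) (Nat.mod_lt _ (by norm_num)) h13 h7 (by
      rw [Nat.mod_mod_of_dvd y (by norm_num : 2 ∣ 6)]
      rcases Nat.lt_or_ge x 3 with hx | hx
      · interval_cases x
        · right; left; rfl
        · left
          refine ⟨rfl, ?_⟩
          rw [← h8]; omega
        · right; left; rfl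
      · right; right
        have : 10 ^ x % 8 = 0 := by
          obtain ⟨k, rfl⟩ := Nat.exists_eq_add_of_le hx
          rw [pow_add]
          exact Nat.mod_eq_zero_of_dvd ((by norm_num : 8 ∣ 10 ^ 3).mul_right _)
        rw [this] at h8
        rw [← h8]; omega)
  omega

lemma class_bit {a b c : ℕ} (hodd : Odd c) (hac : a.Coprime c) (hbc : b.Coprime c)
    {p : ℕ} (hp : p.Prime) (hpc : p ∣ c) :
    ∃ h : ℕ × ℕ × ℕ → Bool, ∀ s t, IsSol a b c s → IsSol a b c t → h s = h t →
      s.1 % 2 = t.1 % 2 ∧ s.2.1 % 2 = t.2.1 % 2 := by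
  have : Fact p.Prime := ⟨hp⟩
  have ha0 := natCast_ne hac hp hpc
  have hb0 := natCast_ne hbc hp hpc
  have hp2 : p ≠ 2 := by
    rintro rfl
    exact (Nat.not_even_iff_odd.mpr hodd) (even_iff_two_dvd.mpr hpc)
  have red : ∀ s, IsSol a b c s → (Units.mk0 _ ha0) ^ s.1 = -1 * (Units.mk0 _ hb0) ^ s.2.1 := by
    intro s hs
    have := sol_mod hs hpc
    ext
    simp only [Units.val_pow_eq_pow_val, Units.val_mk0, Units.val_mul, Units.val_neg, Units.val_one]
    linear_combination this
  by_cases H : ∀ s t, IsSol a b c s → IsSol a b c t → s.2.1 % 2 = t.2.1 % 2 → s.1 % 2 = t.1 % 2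
  · refine ⟨fun s => decide (s.2.1 % 2 = 0), fun s t hs ht h => ?_⟩
    rw [decide_eq_decide] at h
    have h2 : s.2.1 % 2 = t.2.1 % 2 := by omega
    exact ⟨H s t hs ht h2, h2⟩
  · push Not at H
    obtain ⟨s1, s2, hs1, hs2, e1, e2⟩ := H
    refine ⟨fun s => decide (s.1 % 2 = 0), fun s t hs ht h => ?_⟩
    rw [decide_eq_decide] at h
    have h2 : s.1 % 2 = t.1 % 2 := by omega
    refine ⟨h2, ?_⟩
    by_contra h3
    exact two_classes hp2 _ _ _ _ _ _ _ _ _ _ (red s1 hs1) (red s2 hs2) (red s hs) (red t ht)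
      e1 e2 h2 h3

lemma ures_ne {a b c : ℕ} (hac : a.Coprime c) (hbc : b.Coprime c) {p : ℕ} (hp : p.Prime)
    (hpc : p ∣ c) (s : ℕ × ℕ × ℕ) : ures a b p s ≠ 0 := by
  have : Fact p.Prime := ⟨hp⟩
  have ha0 := natCast_ne hac hp hpc
  have hb0 := natCast_ne hbc hp hpc
  exact mul_ne_zero (pow_ne_zero _ ha0) (inv_ne_zero (pow_ne_zero _ hb0))

lemma exc_bound {a b : ℕ} (ha : 2 ≤ a) (hb : 2 ≤ b) (hab : a.Coprime b)
    (hac : a.Coprime 13) (hbc : b.Coprime 13)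
    (hpar : ∀ s, IsSol a b 13 s → s.1 % 2 = 1 ∧ s.2.1 % 2 = 1)
    (hE : ∀ x y x' y', Exc a b 13 x y → Exc a b 13 x' y' → x = x' ∧ y = y') :
    {s | IsSol a b 13 s}.ncard ≤ 2 := by
  classical
  refine ncard_le_of_inj _ (fun s : ℕ × ℕ × ℕ => decide (Exc a b 13 s.1 s.2.1)) ?_
  intro s hs t ht h
  rw [decide_eq_decide] at h
  have hs1 := hpar s hs
  have ht1 := hpar t ht
  have h13 : Nat.Prime 13 := by norm_num
  have main : s = t ∨ Exc a b 13 s.1 s.2.1 ∨ Exc a b 13 t.1 t.2.1 := by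
    have hx : s.1 % 2 = t.1 % 2 := by omega
    have hy : s.2.1 % 2 = t.2.1 % 2 := by omega
    rcases compat hac hbc hs ht hx hy h13 dvd_rfl with h1 | h1
    · refine same_of_sign ha hb (by norm_num) (by decide) hab hac hbc hs ht hx hy 1 ?_
      intro p hp hpc
      obtain rfl := (Nat.prime_dvd_prime_iff_eq hp h13).mp hpc
      simpa using h1
    · refine same_of_sign ha hb (by norm_num) (by decide) hab hac hbc hs ht hx hy (-1) ?_
      intro p hp hpc
      obtain rfl := (Nat.prime_dvd_prime_iff_eq hp h13).mp hpc
      simpa using h1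
  rcases main with h1 | h1
  · exact h1
  · have h2 : Exc a b 13 s.1 s.2.1 ∧ Exc a b 13 t.1 t.2.1 := by tauto
    obtain ⟨e1, e2⟩ := hE _ _ _ _ h2.1 h2.2
    obtain ⟨x, y, z⟩ := s
    obtain ⟨x', y', z'⟩ := t
    simp only at e1 e2
    subst e1 e2
    have k1 := hs.2.2.2
    have k2 := ht.2.2.2
    simp only at k1 k2
    rw [k1] at k2
    rw [Nat.pow_right_injective (by norm_num) k2]

lemma coprime_bound {a b c : ℕ} (ha : 2 ≤ a) (hb : 2 ≤ b) (hc : 1 < c) (hodd : Odd c)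
    (hab : a.Coprime b) (hac : a.Coprime c) (hbc : b.Coprime c) :
    {s | IsSol a b c s}.ncard ≤ 2 ^ c.primeFactors.card := by
  classical
  by_cases hE : ∃ x y, Exc a b c x y
  · have hcard : (Nat.primeFactors 13).card = 1 := by
      rw [Nat.Prime.primeFactors (by norm_num)]; rfl
    obtain ⟨x, y, ⟨rfl, rfl, rfl, _, _⟩ | ⟨rfl, rfl, rfl, _, _⟩⟩ := hE
    · rw [hcard, pow_one]
      refine exc_bound ha hb hab hac hbc (fun s hs => parity_exc _ _ _ hs.2.2.1 hs.2.2.2) ?_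
      unfold Exc; omega
    · rw [hcard, pow_one]
      refine exc_bound ha hb hab hac hbc (fun s hs => ?_) ?_
      · have := parity_exc s.2.1 s.1 s.2.2 hs.2.2.1 (by rw [add_comm]; exact hs.2.2.2)
        tauto
      · unfold Exc; omega
  · push Not at hE
    obtain ⟨p0, hp0, hpc0⟩ := Nat.exists_prime_and_dvd hc.ne'
    obtain ⟨h, hh⟩ := class_bit (a := a) (b := b) hodd hac hbc hp0 hpc0
    have hcard : Fintype.card (c.primeFactors → Bool) = 2 ^ c.primeFactors.card := by simp
    rw [← hcard]
    refine ncard_le_of_inj _ (fun s p => if p.1 = p0 then h s else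
      (sg p.1 (ures a b p.1 s) == sg p0 (ures a b p0 s))) ?_
    intro s hs t ht hst
    have hp2 : ∀ p : ℕ, p ∣ c → p ≠ 2 := by
      rintro p hpc rfl
      exact (Nat.not_even_iff_odd.mpr hodd) (even_iff_two_dvd.mpr hpc)
    obtain ⟨hx, hy⟩ := hh s t hs ht (by
      have := congrFun hst ⟨p0, by simp [hp0, hpc0]; omega⟩
      simpa using this)
    have hsg : ∀ p : ℕ, p.Prime → p ∣ c →
        ((sg p (ures a b p s) == sg p0 (ures a b p0 s)) =
        (sg p (ures a b p t) == sg p0 (ures a b p0 t))) := by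
      intro p hp hpc
      by_cases hpp : p = p0
      · subst hpp; simp
      · have := congrFun hst ⟨p, by simp [hp, hpc]; omega⟩
        simpa [hpp] using this
    have hneg : ∀ p : ℕ, p.Prime → p ∣ c → ures a b p s = - ures a b p t →
        sg p (ures a b p s) ≠ sg p (ures a b p t) := by
      intro p hp hpc e
      have : Fact p.Prime := ⟨hp⟩
      rw [e]
      exact sg_neg (hp2 p hpc) _ (ures_ne hac hbc hp hpc t)
    have main : s = t ∨ Exc a b c s.1 s.2.1 ∨ Exc a b c t.1 t.2.1 := by
      rcases compat hac hbc hs ht hx hy hp0 hpc0 with h1 | h1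
      · refine same_of_sign ha hb (by omega) hodd hab hac hbc hs ht hx hy 1 ?_
        intro p hp hpc
        have e := hsg p hp hpc
        rcases compat hac hbc hs ht hx hy hp hpc with h2 | h2
        · simpa using h2
        · exfalso
          have := hneg p hp hpc h2
          rw [h1] at e
          revert e this
          cases sg p (ures a b p s) <;> cases sg p (ures a b p t) <;>
            cases sg p0 (ures a b p0 t) <;> simp
      · refine same_of_sign ha hb (by omega) hodd hab hac hbc hs ht hx hy (-1) ?_
        intro p hp hpc
        have e := hsg p hp hpc
        rcases compat hac hbc hs ht hx hy hp hpc with h2 | h2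
        · exfalso
          have := hneg p0 hp0 hpc0 h1
          rw [h2] at e
          revert e this
          cases sg p0 (ures a b p0 s) <;> cases sg p (ures a b p t) <;>
            cases sg p0 (ures a b p0 t) <;> simp
        · simpa using h2
    rcases main with h1 | h1 | h1
    · exact h1
    · exact absurd h1 (hE _ _)
    · exact absurd h1 (hE _ _)
/-- The minimum of three numbers is attained at least twice. -/
def Tm {K : Type*} [LinearOrder K] (p q r : K) : Prop :=
  min p q ≤ r ∧ min p r ≤ q ∧ min q r ≤ p

lemma val_Tm {A B C p : ℕ} (hp : p.Prime) (hA : 0 < A) (hB : 0 < B) (h : A + B = C) :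
    Tm (A.factorization p) (B.factorization p) (C.factorization p) := by
  have hC : 0 < C := by omega
  refine ⟨?_, ?_, ?_⟩
  · rw [← hp.pow_dvd_iff_le_factorization hC.ne', ← h]
    exact dvd_add ((hp.pow_dvd_iff_le_factorization hA.ne').mpr (min_le_left _ _))
      ((hp.pow_dvd_iff_le_factorization hB.ne').mpr (min_le_right _ _))
  · rw [← hp.pow_dvd_iff_le_factorization hB.ne']
    apply (Nat.dvd_add_right ((hp.pow_dvd_iff_le_factorization hA.ne').mpr (min_le_left _ _))).mp
    rw [h]
    exact ((hp.pow_dvd_iff_le_factorization hC.ne').mpr (min_le_right _ _))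
  · rw [← hp.pow_dvd_iff_le_factorization hA.ne']
    apply (Nat.dvd_add_left ((hp.pow_dvd_iff_le_factorization hB.ne').mpr (min_le_left _ _))).mp
    rw [h]
    exact ((hp.pow_dvd_iff_le_factorization hC.ne').mpr (min_le_right _ _))

lemma sol_Tm {a b c p : ℕ} (hp : p.Prime) (ha : 0 < a) (hb : 0 < b) {s : ℕ × ℕ × ℕ}
    (hs : IsSol a b c s) :
    Tm (s.1 * a.factorization p) (s.2.1 * b.factorization p) (s.2.2 * c.factorization p) := by
  have := val_Tm hp (pow_pos ha s.1) (pow_pos hb s.2.1) hs.2.2.2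
  simpa [Nat.factorization_pow] using this

/-- strict type c -/
def Rc (a b c : ℕ) (s : ℕ × ℕ × ℕ) : Prop := ∀ p : ℕ, p.Prime → p ∣ a → p ∣ b →
  s.1 * a.factorization p = s.2.1 * b.factorization p ∧
  s.1 * a.factorization p < s.2.2 * c.factorization p

/-- strict type b -/
def Rb (a b c : ℕ) (s : ℕ × ℕ × ℕ) : Prop := ∀ p : ℕ, p.Prime → p ∣ a → p ∣ b →
  s.1 * a.factorization p = s.2.2 * c.factorization p ∧
  s.1 * a.factorization p < s.2.1 * b.factorization p

/-- strict type a -/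
def Ra (a b c : ℕ) (s : ℕ × ℕ × ℕ) : Prop := ∀ p : ℕ, p.Prime → p ∣ a → p ∣ b →
  s.2.1 * b.factorization p = s.2.2 * c.factorization p ∧
  s.2.1 * b.factorization p < s.1 * a.factorization p

lemma strict_aux {m M u v w : ℚ} (hm : 0 < m) (hM : m < M) (hw : 0 < w)
    (h : Tm (m * u) (m * v) (M * w)) : u = v ∨ (w < u ∧ w < v) := by
  obtain ⟨_, h2, h3⟩ := h
  by_cases huv : u = v
  · exact Or.inl huv
  · right
    have hmw : m * w < M * w := by nlinarith
    rw [min_le_iff] at h2 h3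
    rcases lt_or_gt_of_ne huv with hlt | hlt
    · have hx : m * u < m * v := by nlinarith
      have : M * w ≤ m * u := by
        rcases h3 with h | h
        · linarith
        · exact h
      have : w < u := by
        by_contra hcon
        push Not at hcon
        have : m * u ≤ m * w := by nlinarith
        linarith
      exact ⟨this, this.trans hlt⟩
    · have hx : m * v < m * u := by nlinarith
      have : M * w ≤ m * v := by
        rcases h2 with h | h
        · linarith
        · exact h
      have : w < v := by
        by_contra hcon
        push Not at hcon
        have : m * v ≤ m * w := by nlinarith
        linarith
      exact ⟨this.trans hlt, this⟩

lemma Tm_rot {K : Type*} [LinearOrder K] {p q r : K} (h : Tm p q r) : Tm q r p := by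
  obtain ⟨h1, h2, h3⟩ := h
  exact ⟨h3, by rwa [min_comm], by rwa [min_comm]⟩

lemma vertex_aux {m u v w : ℚ} (hm : 0 < m)
    (h : Tm (m * u) (m * v) (m * w)) : Tm u v w := by
  unfold Tm at *
  simpa only [min_le_iff, mul_le_mul_iff_right₀ hm] using h

lemma local_type {X Y Z : ℕ} (hX : 0 < X) (hY : 0 < Y) (hZ : 0 < Z) (h : Tm X Y Z) {u v w : ℚ}
    (hu : 0 < u) (hv : 0 < v) (hw : 0 < w) (h' : Tm (X * u) (Y * v) (Z * w)) :
    Tm u v w ∨ (X = Y ∧ X < Z ∧ (u = v ∨ (w < u ∧ w < v))) ∨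
      (X = Z ∧ X < Y ∧ (w = u ∨ (v < w ∧ v < u))) ∨
      (Y = Z ∧ Y < X ∧ (v = w ∨ (u < v ∧ u < w))) := by
  have hX' : (0 : ℚ) < X := by exact_mod_cast hX
  have hY' : (0 : ℚ) < Y := by exact_mod_cast hY
  have hZ' : (0 : ℚ) < Z := by exact_mod_cast hZ
  have hc : (X = Y ∧ Y = Z) ∨ (X = Y ∧ X < Z) ∨ (X = Z ∧ X < Y) ∨ (Y = Z ∧ Y < X) := by
    unfold Tm at h; omega
  rcases hc with ⟨rfl, rfl⟩ | ⟨rfl, hlt⟩ | ⟨rfl, hlt⟩ | ⟨rfl, hlt⟩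
  · exact Or.inl (vertex_aux hX' h')
  · exact Or.inr (Or.inl ⟨rfl, hlt, strict_aux hX' (by exact_mod_cast hlt) hw h'⟩)
  · refine Or.inr (Or.inr (Or.inl ⟨rfl, hlt, ?_⟩))
    exact strict_aux hX' (by exact_mod_cast hlt) hv (Tm_rot (Tm_rot h'))
  · refine Or.inr (Or.inr (Or.inr ⟨rfl, hlt, ?_⟩))
    exact strict_aux hY' (by exact_mod_cast hlt) hu (Tm_rot h')

lemma mixed_T {a b c : ℕ} (ha : 0 < a) (hb : 0 < b)
    (hS : ∀ p : ℕ, p.Prime → p ∣ a → p ∣ b → p ∣ c) {s t : ℕ × ℕ × ℕ} (hs : IsSol a b c s)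
    (ht : IsSol a b c t) (h1 : ¬ Rc a b c s) (h2 : ¬ Rb a b c s) (h3 : ¬ Ra a b c s) :
    Tm ((t.1 : ℚ) / s.1) ((t.2.1 : ℚ) / s.2.1) ((t.2.2 : ℚ) / s.2.2) := by
  have hs1 : (0 : ℚ) < s.1 := by exact_mod_cast hs.1
  have hs2 : (0 : ℚ) < s.2.1 := by exact_mod_cast hs.2.1
  have hs3 : (0 : ℚ) < s.2.2 := by exact_mod_cast hs.2.2.1
  have ht1 : (0 : ℚ) < t.1 := by exact_mod_cast ht.1
  have ht2 : (0 : ℚ) < t.2.1 := by exact_mod_cast ht.2.1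
  have ht3 : (0 : ℚ) < t.2.2 := by exact_mod_cast ht.2.2.1
  have hc : 0 < c := by
    rcases Nat.eq_zero_or_pos c with h | h
    · exfalso
      have h4 := hs.2.2.2
      rw [h, zero_pow hs.2.2.1.ne'] at h4
      have := pow_pos ha s.1
      omega
    · exact h
  set u := (t.1 : ℚ) / s.1 with hu
  set v := (t.2.1 : ℚ) / s.2.1 with hv
  set w := (t.2.2 : ℚ) / s.2.2 with hw
  have key : ∀ p : ℕ, p.Prime → p ∣ a → p ∣ b → _ := fun p hp hpa hpb =>
    local_type (X := s.1 * a.factorization p) (Y := s.2.1 * b.factorization p)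
      (Z := s.2.2 * c.factorization p) (u := u) (v := v) (w := w)
      (mul_pos hs.1 (hp.factorization_pos_of_dvd ha.ne' hpa))
      (mul_pos hs.2.1 (hp.factorization_pos_of_dvd hb.ne' hpb))
      (mul_pos hs.2.2.1 (hp.factorization_pos_of_dvd hc.ne' (hS p hp hpa hpb)))
      (sol_Tm hp ha hb hs) (by positivity) (by positivity) (by positivity) (by
        have := sol_Tm hp ha hb ht
        have e1 : ((s.1 * a.factorization p : ℕ) : ℚ) * u = ((t.1 * a.factorization p : ℕ) : ℚ) := by
          rw [hu]; push_cast; field_simp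
        have e2 : ((s.2.1 * b.factorization p : ℕ) : ℚ) * v
            = ((t.2.1 * b.factorization p : ℕ) : ℚ) := by
          rw [hv]; push_cast; field_simp
        have e3 : ((s.2.2 * c.factorization p : ℕ) : ℚ) * w
            = ((t.2.2 * c.factorization p : ℕ) : ℚ) := by
          rw [hw]; push_cast; field_simp
        rw [e1, e2, e3]
        unfold Tm at *
        exact_mod_cast this)
  unfold Rc at h1
  unfold Rb at h2
  unfold Ra at h3
  push Not at h1 h2 h3
  obtain ⟨p1, hp1, hpa1, hpb1, g1⟩ := h1
  obtain ⟨p2, hp2, hpa2, hpb2, g2⟩ := h2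
  obtain ⟨p3, hp3, hpa3, hpb3, g3⟩ := h3
  have k1 := key p1 hp1 hpa1 hpb1
  have k2 := key p2 hp2 hpa2 hpb2
  have k3 := key p3 hp3 hpa3 hpb3
  by_contra hT
  have hT' : ¬ (u = v ∧ v = w) := by
    rintro ⟨e1, e2⟩
    apply hT
    rw [e1, e2]; unfold Tm; simp
  have m1 : (w = u ∨ (v < w ∧ v < u)) ∨ (v = w ∨ (u < v ∧ u < w)) := by
    rcases k1 with k | k | k | k
    · exact absurd k hT
    · have := g1 k.1; omega
    · exact Or.inl k.2.2
    · exact Or.inr k.2.2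
  have m2 : (u = v ∨ (w < u ∧ w < v)) ∨ (v = w ∨ (u < v ∧ u < w)) := by
    rcases k2 with k | k | k | k
    · exact absurd k hT
    · exact Or.inl k.2.2
    · have := g2 k.1; omega
    · exact Or.inr k.2.2
  have m3 : (u = v ∨ (w < u ∧ w < v)) ∨ (w = u ∨ (v < w ∧ v < u)) := by
    rcases k3 with k | k | k | k
    · exact absurd k hT
    · exact Or.inl k.2.2
    · exact Or.inr k.2.2
    · have := g3 k.1; omega
  clear key k1 k2 k3
  clear_value u v w
  grind

lemma prop_unique {a b c : ℕ} (ha : 0 < a) (hb : 0 < b) {s t : ℕ × ℕ × ℕ} (hs : IsSol a b c s)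
    (ht : IsSol a b c t) (h1 : t.1 * s.2.1 = t.2.1 * s.1) (h2 : t.1 * s.2.2 = t.2.2 * s.1) :
    ¬ s.1 < t.1 := by
  intro hlt
  obtain ⟨x, y, z⟩ := s
  obtain ⟨x', y', z'⟩ := t
  obtain ⟨hx, hy, hz, h⟩ := hs
  obtain ⟨hx', hy', hz', h'⟩ := ht
  simp only at *
  have hA : 0 < a ^ x := pow_pos ha _
  have hB : 0 < b ^ y := pow_pos hb _
  have main : ∀ d e e' : ℕ, 0 < d → d ^ e < c ^ z → x' * e = e' * x →
      d ^ e' * c ^ z < c ^ z' * d ^ e := by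
    intro d e e' hd hlt' he
    apply lt_of_pow_lt_pow_left₀ x (by positivity)
    obtain ⟨k, rfl⟩ := Nat.exists_eq_add_of_lt hlt
    have e1 : (d ^ e') ^ x = (d ^ e) ^ (x + k + 1) := by
      rw [← pow_mul, ← he, ← pow_mul, mul_comm e]
    have e2 : (c ^ z') ^ x = (c ^ z) ^ (x + k + 1) := by
      rw [← pow_mul, ← h2, ← pow_mul, mul_comm z]
    rw [mul_pow, mul_pow, e1, e2, add_assoc, pow_add (d ^ e) x (k + 1), pow_add (c ^ z) x (k + 1)]
    have := Nat.pow_lt_pow_left hlt' (show k + 1 ≠ 0 by omega)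
    have hp : 0 < (d ^ e) ^ x * (c ^ z) ^ x := by
      have : 0 < c ^ z := by omega
      positivity
    generalize (d ^ e) ^ x = X1 at *
    generalize (c ^ z) ^ x = X2 at *
    calc _ = X1 * X2 * (d ^ e) ^ (k + 1) := by ring
      _ < X1 * X2 * (c ^ z) ^ (k + 1) := Nat.mul_lt_mul_of_pos_left this hp
      _ = _ := by ring
  have m1 := main a x x' ha (by omega) rfl
  have m2 := main b y y' hb (by omega) h1
  have : (a ^ x' + b ^ y') * c ^ z < c ^ z' * (a ^ x + b ^ y) := by nlinarith
  rw [h, h'] at this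
  exact lt_irrefl _ this

lemma mixed_unique {a b c : ℕ} (ha : 0 < a) (hb : 0 < b)
    (hS : ∀ p : ℕ, p.Prime → p ∣ a → p ∣ b → p ∣ c) {s t : ℕ × ℕ × ℕ} (hs : IsSol a b c s)
    (ht : IsSol a b c t) (h1 : ¬ Rc a b c s) (h2 : ¬ Rb a b c s) (h3 : ¬ Ra a b c s)
    (h1' : ¬ Rc a b c t) (h2' : ¬ Rb a b c t) (h3' : ¬ Ra a b c t) : s = t := by
  have T1 := mixed_T ha hb hS hs ht h1 h2 h3
  have T2 := mixed_T ha hb hS ht hs h1' h2' h3'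
  have hs1 : (0 : ℚ) < s.1 := by exact_mod_cast hs.1
  have hs2 : (0 : ℚ) < s.2.1 := by exact_mod_cast hs.2.1
  have hs3 : (0 : ℚ) < s.2.2 := by exact_mod_cast hs.2.2.1
  have ht1 : (0 : ℚ) < t.1 := by exact_mod_cast ht.1
  have ht2 : (0 : ℚ) < t.2.1 := by exact_mod_cast ht.2.1
  have ht3 : (0 : ℚ) < t.2.2 := by exact_mod_cast ht.2.2.1
  rw [← inv_div (t.1 : ℚ), ← inv_div (t.2.1 : ℚ), ← inv_div (t.2.2 : ℚ)] at T2
  have hu : 0 < (t.1 : ℚ) / s.1 := by positivity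
  have hv : 0 < (t.2.1 : ℚ) / s.2.1 := by positivity
  have hw : 0 < (t.2.2 : ℚ) / s.2.2 := by positivity
  have hkey : (t.1 : ℚ) / s.1 = (t.2.1 : ℚ) / s.2.1 ∧ (t.1 : ℚ) / s.1 = (t.2.2 : ℚ) / s.2.2 := by
    unfold Tm at T1 T2
    simp only [min_le_iff] at T1 T2
    rw [inv_le_inv₀ hu hw, inv_le_inv₀ hv hw, inv_le_inv₀ hu hv, inv_le_inv₀ hw hv,
      inv_le_inv₀ hv hu, inv_le_inv₀ hw hu] at T2
    generalize (t.1 : ℚ) / s.1 = u at *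
    generalize (t.2.1 : ℚ) / s.2.1 = v at *
    generalize (t.2.2 : ℚ) / s.2.2 = w at *
    grind
  obtain ⟨e1, e2⟩ := hkey
  rw [div_eq_div_iff hs1.ne' hs2.ne'] at e1
  rw [div_eq_div_iff hs1.ne' hs3.ne'] at e2
  have e1' : t.1 * s.2.1 = t.2.1 * s.1 := by exact_mod_cast e1
  have e2' : t.1 * s.2.2 = t.2.2 * s.1 := by exact_mod_cast e2
  have n1 := prop_unique ha hb hs ht e1' e2'
  have n2 := prop_unique ha hb ht hs (by linarith) (by linarith)
  have e0 : s.1 = t.1 := by omega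
  rw [← e0, mul_comm] at e1' e2'
  have e3 := Nat.eq_of_mul_eq_mul_right hs.1 e1'
  have e4 := Nat.eq_of_mul_eq_mul_right hs.1 e2'
  ext <;> assumption
lemma lte_dvd (x y : ℤ) (hxy : IsCoprime x y) {q : ℕ} (hq : q.Prime) (hqo : Odd q)
    (H : ∀ p : ℕ, p.Prime → (p : ℤ) ∣ x ^ q - y ^ q → (p : ℤ) ∣ x - y) :
    x ^ q - y ^ q ∣ q * (x - y) := by
  rw [← Int.natAbs_dvd_natAbs, Nat.dvd_iff_prime_pow_dvd_dvd]
  intro r k hr hk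
  rcases Nat.eq_zero_or_pos k with rfl | hk0
  · simp
  rw [← Int.natCast_dvd] at hk ⊢
  push_cast at hk ⊢
  have h1 : (r : ℤ) ∣ x ^ q - y ^ q := (dvd_pow_self _ hk0.ne').trans hk
  have h2 := H r hr h1
  have hr' : Prime (r : ℤ) := Nat.prime_iff_prime_int.mp hr
  have hx : ¬ (r : ℤ) ∣ x := by
    intro hx
    have hy : (r : ℤ) ∣ y := by
      have := dvd_sub hx h2
      simpa using this
    exact hr'.not_isUnit (hxy.isUnit_of_dvd' hx hy)
  by_cases hrq : r = q
  · subst hrq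
    have := Int.emultiplicity_pow_sub_pow hr hqo h2 hx r
    rw [pow_dvd_iff_le_emultiplicity] at hk ⊢
    rw [emultiplicity_mul hr', add_comm]
    rw [this] at hk
    rwa [Int.natCast_emultiplicity]
  · have hn : ¬ (r : ℤ) ∣ (q : ℤ) := by
      intro h
      exact hrq ((Nat.prime_dvd_prime_iff_eq hr hq).mp (by exact_mod_cast h))
    have := emultiplicity_pow_sub_pow_of_prime hr' h2 hx hn
    rw [pow_dvd_iff_le_emultiplicity, this, ← pow_dvd_iff_le_emultiplicity] at hk
    exact hk.mul_left _

lemma plus_size {u v q : ℕ} (hq3 : 3 ≤ q) (hqo : Odd q) (hv : 1 ≤ v) (huv : v < u)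
    (h : u ^ q + v ^ q ≤ q * (u + v)) : q = 3 ∧ u + v = 3 := by
  obtain ⟨k, rfl⟩ := Nat.exists_eq_add_of_le hq3
  have h1 : u * u ^ (2 + k) < u * (2 * (3 + k)) := by
    calc u * u ^ (2 + k) = u ^ (3 + k) := by rw [← pow_succ']; congr 1; ring
      _ ≤ (3 + k) * (u + v) := by omega
      _ < (3 + k) * (u + u) := by
        apply Nat.mul_lt_mul_of_pos_left <;> omega
      _ = _ := by ring
  have h2 : u ^ (2 + k) < 2 * (3 + k) := Nat.lt_of_mul_lt_mul_left h1
  have h3 : 2 ^ (2 + k) ≤ u ^ (2 + k) := Nat.pow_le_pow_left (by omega) _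
  have h4 : k < 2 := by
    by_contra hk
    have : ∀ j : ℕ, 2 * (3 + (j + 2)) ≤ 2 ^ (2 + (j + 2)) := by
      intro j
      induction j with
      | zero => norm_num
      | succ j ih =>
        have : 2 ^ (2 + (j + 1 + 2)) = 2 * 2 ^ (2 + (j + 2)) := by ring
        omega
    have := this (k - 2)
    rw [Nat.sub_add_cancel (by omega)] at this
    omega
  have h5 : k = 0 := by
    rcases hqo with ⟨m, hm⟩
    omega
  subst h5
  simp only [add_zero] at h2
  have : u < 3 := by nlinarith
  omega

lemma q_plus {u v q : ℕ} (huv : u.Coprime v) (hu : 0 < u) (hv : 0 < v) (h3 : 3 ≤ u + v)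
    (hq : q.Prime) (hqo : Odd q)
    (H : ∀ p : ℕ, p.Prime → p ∣ u ^ q + v ^ q → p ∣ u + v) : q = 3 ∧ u + v = 3 := by
  have hq3 : 3 ≤ q := by
    have := hq.two_le
    rcases hqo with ⟨m, hm⟩
    omega
  have h1 := lte_dvd (u : ℤ) (-(v : ℤ)) ((Nat.isCoprime_iff_coprime.mpr huv).neg_right) hq hqo (by
    intro p hp hpd
    rw [hqo.neg_pow, sub_neg_eq_add] at hpd
    rw [sub_neg_eq_add]
    have := H p hp (by exact_mod_cast hpd)
    exact_mod_cast this)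
  rw [hqo.neg_pow, sub_neg_eq_add, sub_neg_eq_add] at h1
  have h2 : u ^ q + v ^ q ∣ q * (u + v) := by exact_mod_cast h1
  have h4 := Nat.le_of_dvd (by positivity) h2
  rcases lt_trichotomy u v with h | h | h
  · rw [add_comm u v, add_comm (u ^ q)] at *
    exact plus_size hq3 hqo hu h h4
  · subst h
    have : u = 1 := by simpa using huv
    omega
  · exact plus_size hq3 hqo hv h h4

lemma core_plus {u v t : ℕ} (huv : u.Coprime v) (hu : 0 < u) (hv : 0 < v) (h3 : 3 ≤ u + v)
    (ht : 1 < t) (hto : Odd t)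
    (H : ∀ p : ℕ, p.Prime → p ∣ u ^ t + v ^ t → p ∣ u + v) : t = 3 ∧ u + v = 3 := by
  have hdiv : ∀ q, q ∣ t → u ^ q + v ^ q ∣ u ^ t + v ^ t := by
    rintro q ⟨m, rfl⟩
    rw [pow_mul, pow_mul]
    exact (Nat.odd_mul.mp hto).2.nat_add_dvd_pow_add_pow _ _
  have key : ∀ q, q.Prime → q ∣ t → q = 3 ∧ u + v = 3 := by
    intro q hq hqt
    exact q_plus huv hu hv h3 hq (hto.of_dvd_nat hqt) (fun p hp hpd => H p hp (hpd.trans (hdiv q hqt)))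
  obtain ⟨q, hq, hqt⟩ := Nat.exists_prime_and_dvd ht.ne'
  obtain ⟨rfl, hs⟩ := key q hq hqt
  refine ⟨?_, hs⟩
  obtain ⟨m, rfl⟩ := hqt
  by_contra hne
  obtain ⟨q', hq', hqt'⟩ := Nat.exists_prime_and_dvd (show m ≠ 1 by omega)
  obtain ⟨rfl, _⟩ := key q' hq' (hqt'.mul_left 3)
  have h9 : 9 ∣ 3 * m := by omega
  have h19 := H 19 (by norm_num) (dvd_trans ?_ (hdiv 9 h9))
  · rw [hs] at h19; omega
  · have : u < 3 := by omega
    interval_cases u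
    · obtain rfl : v = 2 := by omega
      norm_num
    · obtain rfl : v = 1 := by omega
      norm_num

lemma minus_size (u v : ℤ) (hv : 1 ≤ v) (huv : v < u) (n : ℕ) :
    (n + 2) * (u - v) < u ^ (n + 2) - v ^ (n + 2) := by
  induction n with
  | zero =>
    simp only [Nat.cast_zero, zero_add]
    nlinarith
  | succ n ih =>
    have e : u ^ (n + 1 + 2) - v ^ (n + 1 + 2) = u * (u ^ (n + 2) - v ^ (n + 2)) + v ^ (n + 2) * (u - v) := by
      ring
    have h1 : 1 ≤ v ^ (n + 2) := one_le_pow₀ hv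
    rw [e]
    push_cast
    have h0 : (0 : ℤ) ≤ n := by positivity
    have h2 : (n + 2) * (u - v) < u * (u ^ (n + 2) - v ^ (n + 2)) := by
      have : 0 < (n + 2) * (u - v) := by apply mul_pos <;> linarith
      nlinarith
    nlinarith

lemma pow_two_of {n : ℕ} (hn : n ≠ 0) (h : ∀ r : ℕ, r.Prime → r ∣ n → r = 2) : ∃ k, n = 2 ^ k :=
  ⟨_, Nat.eq_prime_pow_of_unique_prime_dvd hn (fun {d} hd hdn => h d hd hdn)⟩

lemma core_minus {u v t : ℕ} (huv : u.Coprime v) (hv : 0 < v) (hlt : v < u) (ht : 1 < t)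
    (H : ∀ p : ℕ, p.Prime → (p : ℤ) ∣ (u : ℤ) ^ t - (v : ℤ) ^ t → (p : ℤ) ∣ (u : ℤ) - v) :
    t = 2 ∧ ∃ k, u + v = 2 ^ k := by
  have huv' : IsCoprime (u : ℤ) (v : ℤ) := Nat.isCoprime_iff_coprime.mpr huv
  have hdiv : ∀ q, q ∣ t → (u : ℤ) ^ q - (v : ℤ) ^ q ∣ (u : ℤ) ^ t - (v : ℤ) ^ t := by
    rintro q ⟨m, rfl⟩
    rw [pow_mul, pow_mul]
    exact sub_dvd_pow_sub_pow _ _ _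
  have hodd : ¬ ∃ q, q.Prime ∧ q ∣ t ∧ Odd q := by
    rintro ⟨q, hq, hqt, hqo⟩
    have h1 := lte_dvd _ _ huv' hq hqo (fun p hp hpd => H p hp (hpd.trans (hdiv q hqt)))
    have hq2 := hq.two_le
    obtain ⟨n, rfl⟩ := Nat.exists_eq_add_of_le hq2
    have h2 := minus_size u v (by exact_mod_cast hv) (by exact_mod_cast hlt) n
    have h3 := Int.le_of_dvd (by
      have : (0 : ℤ) < (u : ℤ) - v := by
        have : (v : ℤ) < u := by exact_mod_cast hlt
        linarith
      positivity) h1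
    rw [add_comm 2 n] at h3
    push_cast at h3
    linarith
  have two_of : ∀ r : ℕ, r.Prime → (r : ℤ) ∣ u - v → (∃ j, (r : ℤ) ∣ 2 * (u : ℤ) ^ j) → r = 2 := by
    rintro r hr h1 ⟨j, h2⟩
    have hr' : Prime (r : ℤ) := Nat.prime_iff_prime_int.mp hr
    rcases hr'.dvd_or_dvd h2 with h | h
    · exact (Nat.prime_dvd_prime_iff_eq hr Nat.prime_two).mp (by exact_mod_cast h)
    · exfalso
      have h3 := hr'.dvd_of_dvd_pow h
      have h4 : (r : ℤ) ∣ v := by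
        have := dvd_sub h3 h1
        simpa using this
      exact hr'.not_isUnit (huv'.isUnit_of_dvd' h3 h4)
  obtain ⟨j, rfl⟩ : ∃ j, t = 2 ^ j := by
    rcases Nat.eq_two_pow_or_exists_odd_prime_and_dvd t with h | ⟨p, h1, h2, h3⟩
    · exact h
    · exact absurd ⟨p, h1, h2, h3⟩ hodd
  have hj : j ≠ 0 := by rintro rfl; simp at ht
  have hk : ∃ k, u + v = 2 ^ k := by
    apply pow_two_of (by omega)
    intro r hr hrd
    have hrd' : (r : ℤ) ∣ (u : ℤ) + v := by exact_mod_cast hrd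
    have h1 := H r hr (dvd_trans (by
      rw [sq_sub_sq]; exact hrd'.mul_right _) (hdiv 2 (dvd_pow_self 2 hj)))
    refine two_of r hr h1 ⟨1, ?_⟩
    have := dvd_add hrd' h1
    have e : (2 : ℤ) * (u : ℤ) ^ 1 = (u + v) + (u - v) := by ring
    rwa [e]
  refine ⟨?_, hk⟩
  by_contra hne
  have hj2 : 2 ≤ j := by
    rcases j with _ | _ | j
    · exact absurd rfl hj
    · simp at hne
    · omega
  have hl : ∃ l, u ^ 2 + v ^ 2 = 2 ^ l := by
    apply pow_two_of (by positivity)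
    intro r hr hrd
    have hrd' : (r : ℤ) ∣ (u : ℤ) ^ 2 + (v : ℤ) ^ 2 := by exact_mod_cast hrd
    have h1 := H r hr (dvd_trans (by
      have : (u : ℤ) ^ 4 - (v : ℤ) ^ 4 = ((u : ℤ) ^ 2 + (v : ℤ) ^ 2) * ((u : ℤ) ^ 2 - (v : ℤ) ^ 2) := by
        ring
      rw [this]; exact hrd'.mul_right _) (hdiv 4 (pow_dvd_pow 2 hj2)))
    refine two_of r hr h1 ⟨2, ?_⟩
    have := dvd_add hrd' (h1.mul_right ((u : ℤ) + v))
    have e : (2 : ℤ) * (u : ℤ) ^ 2 = (u ^ 2 + v ^ 2) + (u - v) * (u + v) := by ring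
    rwa [e]
  obtain ⟨k, hk⟩ := hk
  obtain ⟨l, hl⟩ := hl
  have hk1 : k ≠ 0 := by rintro rfl; simp at hk; omega
  have hl2 : 2 ≤ l := by
    rcases l with _ | _ | l
    · simp at hl; nlinarith
    · simp at hl; nlinarith
    · omega
  have e1 : 2 ∣ u + v := by rw [hk]; exact dvd_pow_self 2 hk1
  have e2 : 4 ∣ u ^ 2 + v ^ 2 := by rw [hl]; exact pow_dvd_pow 2 hl2
  have e3 : (u ^ 2 + v ^ 2) % 4 = ((u % 4) ^ 2 + (v % 4) ^ 2) % 4 := by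
    simp [Nat.add_mod, Nat.pow_mod]
  have e4 : ¬ (2 ∣ u ∧ 2 ∣ v) := by
    rintro ⟨h1, h2⟩
    have := Nat.eq_one_of_dvd_coprimes huv h1 h2
    omega
  have e5 : u % 4 = 1 ∨ u % 4 = 3 := by omega
  have e6 : v % 4 = 1 ∨ v % 4 = 3 := by omega
  rcases e5 with h | h <;> rcases e6 with h' | h' <;> rw [h, h'] at e3 <;> norm_num at e3 <;> omega
lemma prop_decomp {x1 x2 y1 y2 : ℕ} (hx1 : 0 < x1) (hx2 : 0 < x2)
    (h : x1 * y2 = x2 * y1) : ∃ x0 y0 t1 t2 : ℕ, t1.Coprime t2 ∧ x1 = x0 * t1 ∧ x2 = x0 * t2 ∧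
      y1 = y0 * t1 ∧ y2 = y0 * t2 := by
  obtain ⟨t1, t2, hc, e1, e2⟩ := Nat.exists_coprime x1 x2
  set g := x1.gcd x2 with hg
  have hg0 : 0 < g := Nat.gcd_pos_of_pos_left _ hx1
  have ht1 : 0 < t1 := by
    rcases Nat.eq_zero_or_pos t1 with h | h
    · rw [h, zero_mul] at e1; omega
    · exact h
  have h2 : t1 * y2 = t2 * y1 := by
    apply Nat.eq_of_mul_eq_mul_left hg0
    rw [e1, e2] at h
    linarith
  have h3 : t1 ∣ y1 := hc.dvd_of_dvd_mul_left (h2 ▸ Dvd.intro _ rfl)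
  obtain ⟨y0, rfl⟩ := h3
  refine ⟨g, y0, t1, t2, hc, by rw [mul_comm]; exact e1, by rw [mul_comm]; exact e2, mul_comm _ _, ?_⟩
  apply Nat.eq_of_mul_eq_mul_left ht1
  rw [h2]; ring

lemma cof {D W E p : ℕ} (hp : p.Prime) (hE : D * W = E) (hE0 : E ≠ 0)
    (h : D.factorization p < E.factorization p) : p ∣ W := by
  by_contra hW
  have hD0 : D ≠ 0 := by rintro rfl; simp at hE; exact hE0 hE.symm
  have hW0 : W ≠ 0 := by rintro rfl; exact hW (dvd_zero _)
  rw [← hE, Nat.factorization_mul hD0 hW0] at h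
  simp [Nat.factorization_eq_zero_of_not_dvd hW] at h

lemma unit_order {G : Type*} [Monoid G] (r : G) {t1 t2 : ℕ} (h : t1.Coprime t2) (h1 : r ^ t1 = 1)
    (h2 : r ^ t2 = 1) : r = 1 := by
  rw [← orderOf_eq_one_iff]
  exact Nat.eq_one_of_dvd_coprimes h (orderOf_dvd_of_pow_eq_one h1) (orderOf_dvd_of_pow_eq_one h2)

lemma minus_res {K : Type*} [Field K] {u v : K} (hv : v ≠ 0) {t1 t2 : ℕ} (h : t1.Coprime t2)
    (h1 : u ^ t1 = v ^ t1) (h2 : u ^ t2 = v ^ t2) : u = v := by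
  have := unit_order (u / v) h (by rw [div_pow, h1, div_self (pow_ne_zero _ hv)])
    (by rw [div_pow, h2, div_self (pow_ne_zero _ hv)])
  rwa [div_eq_one_iff_eq hv] at this

lemma plus_res {K : Type*} [Field K] {u v : K} (h2K : (2 : K) ≠ 0) (hv : v ≠ 0) {t1 t2 : ℕ}
    (h : t1.Coprime t2) (h1 : u ^ t1 = -v ^ t1) (h2 : u ^ t2 = -v ^ t2) :
    u = -v ∧ Odd t1 ∧ Odd t2 := by
  have aux : ∀ i j : ℕ, Even i → Odd j → u ^ i = -v ^ i → u ^ j = -v ^ j → False := by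
    intro i j hi hj h1 h2
    have e1 : (u ^ i) ^ j = - (v ^ i) ^ j := by rw [h1, hj.neg_pow]
    have e2 : (u ^ j) ^ i = (v ^ j) ^ i := by rw [h2, hi.neg_pow]
    rw [← pow_mul, ← pow_mul] at e1 e2
    rw [mul_comm j i] at e2
    rw [e1] at e2
    have e3 : (2 : K) * v ^ (i * j) = 0 := by linear_combination -e2
    exact mul_ne_zero h2K (pow_ne_zero _ hv) e3
  have o1 : Odd t1 := by
    by_contra ho
    rw [Nat.not_odd_iff_even] at ho
    rcases Nat.even_or_odd t2 with h' | h'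
    · have := Nat.eq_one_of_dvd_coprimes h ho.two_dvd h'.two_dvd
      omega
    · exact aux _ _ ho h' h1 h2
  have o2 : Odd t2 := by
    by_contra ho
    rw [Nat.not_odd_iff_even] at ho
    exact aux _ _ ho o1 h2 h1
  refine ⟨?_, o1, o2⟩
  refine minus_res (neg_ne_zero.mpr hv) h ?_ ?_
  · rw [h1, o1.neg_pow]
  · rw [h2, o2.neg_pow]

lemma two_ne {p : ℕ} (hp : p.Prime) (hp2 : p ≠ 2) : (2 : ZMod p) ≠ 0 := by
  intro h5
  have : ((2 : ℕ) : ZMod p) = 0 := by exact_mod_cast h5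
  rw [ZMod.natCast_eq_zero_iff] at this
  exact hp2 ((Nat.prime_dvd_prime_iff_eq hp Nat.prime_two).mp this)

lemma plus_nat {u v t1 t2 p : ℕ} (hp : p.Prime) (hp2 : p ≠ 2) (huv : u.Coprime v)
    (ht1 : t1 ≠ 0) (h : t1.Coprime t2) (h1 : p ∣ u ^ t1 + v ^ t1) (h2 : p ∣ u ^ t2 + v ^ t2) :
    p ∣ u + v ∧ Odd t1 ∧ Odd t2 := by
  have : Fact p.Prime := ⟨hp⟩
  rw [← ZMod.natCast_eq_zero_iff] at h1 h2 ⊢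
  push_cast at h1 h2 ⊢
  have hv : (v : ZMod p) ≠ 0 := by
    intro hv
    rw [hv, zero_pow ht1, add_zero] at h1
    have hu := eq_zero_of_pow_eq_zero h1
    rw [ZMod.natCast_eq_zero_iff] at hu hv
    exact hp.one_lt.ne' (Nat.eq_one_of_dvd_coprimes huv hu hv)
  obtain ⟨e, o⟩ := plus_res (two_ne hp hp2) hv h (eq_neg_of_add_eq_zero_left h1)
    (eq_neg_of_add_eq_zero_left h2)
  exact ⟨by rw [e]; ring, o⟩

lemma minus_int {u v t1 t2 p : ℕ} (hp : p.Prime) (huv : u.Coprime v)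
    (ht1 : t1 ≠ 0) (h : t1.Coprime t2) (h1 : (p : ℤ) ∣ (u : ℤ) ^ t1 - (v : ℤ) ^ t1)
    (h2 : (p : ℤ) ∣ (u : ℤ) ^ t2 - (v : ℤ) ^ t2) : (p : ℤ) ∣ (u : ℤ) - v := by
  have : Fact p.Prime := ⟨hp⟩
  rw [← ZMod.intCast_zmod_eq_zero_iff_dvd] at h1 h2 ⊢
  push_cast at h1 h2 ⊢
  have hv : (v : ZMod p) ≠ 0 := by
    intro hv
    rw [hv, zero_pow ht1, sub_zero] at h1
    have hu := eq_zero_of_pow_eq_zero h1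
    rw [ZMod.natCast_eq_zero_iff] at hu hv
    exact hp.one_lt.ne' (Nat.eq_one_of_dvd_coprimes huv hu hv)
  rw [minus_res hv h (sub_eq_zero.mp h1) (sub_eq_zero.mp h2), sub_self]

lemma Rc_dvd {a b c x0 y0 t u v D : ℕ} (ha : 0 < a) (hc : 0 < c)
    {s : ℕ × ℕ × ℕ} (hs : IsSol a b c s)
    (hR : Rc a b c s) (ex : s.1 = x0 * t) (ey : s.2.1 = y0 * t) (hU : a ^ x0 = u * D)
    (hV : b ^ y0 = v * D) {p : ℕ} (hp : p.Prime) (hpc : p ∣ c) : p ∣ u ^ t + v ^ t := by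
  have hE : D ^ t * (u ^ t + v ^ t) = c ^ s.2.2 := by
    rw [← hs.2.2.2, ex, ey, pow_mul, pow_mul, hU, hV]; ring
  have hE0 : c ^ s.2.2 ≠ 0 := by positivity
  apply cof hp hE hE0
  by_cases hS : p ∣ a ∧ p ∣ b
  · have h1 := (hR p hp hS.1 hS.2).2
    have h2 : D ^ t ∣ a ^ s.1 := by
      rw [ex, pow_mul, hU, mul_pow]; exact Dvd.intro_left _ rfl
    have h3 := (Nat.factorization_le_iff_dvd (ne_zero_of_dvd_ne_zero hE0 (Dvd.intro _ hE))
      (by positivity)).mpr h2 p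
    simp only [Nat.factorization_pow, Finsupp.smul_apply, smul_eq_mul] at h3 ⊢
    omega
  · have h1 : ¬ p ∣ D ^ t := by
      intro h
      have h2 := hp.dvd_of_dvd_pow h
      exact hS ⟨hp.dvd_of_dvd_pow (hU ▸ h2.mul_left _), hp.dvd_of_dvd_pow (hV ▸ h2.mul_left _)⟩
    rw [Nat.factorization_eq_zero_of_not_dvd h1]
    apply hp.factorization_pos_of_dvd hE0
    exact dvd_pow hpc hs.2.2.1.ne'

lemma cross_eq {x1 x2 y1 y2 α β : ℕ} (hα : 0 < α) (hβ : 0 < β) (h1 : x1 * α = y1 * β)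
    (h2 : x2 * α = y2 * β) : x1 * y2 = x2 * y1 := by
  apply Nat.eq_of_mul_eq_mul_right (mul_pos hα hβ)
  calc _ = (x1 * α) * (y2 * β) := by ring
    _ = (y1 * β) * (x2 * α) := by rw [h1, h2]
    _ = _ := by ring

lemma Rc_pair {a b c : ℕ} (ha : 0 < a) (hb : 0 < b) (hc : 1 < c) (hodd : Odd c)
    {p0 : ℕ} (hp0 : p0.Prime) (hpa : p0 ∣ a) (hpb : p0 ∣ b) {s t : ℕ × ℕ × ℕ}
    (hs : IsSol a b c s) (ht : IsSol a b c t) (hRs : Rc a b c s) (hRt : Rc a b c t) :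
    s = t ∨ ((∀ p : ℕ, p.Prime → p ∣ c → p = 3) ∧ (t.1 = 3 * s.1 ∨ s.1 = 3 * t.1)) := by
  have hcr := cross_eq (hp0.factorization_pos_of_dvd ha.ne' hpa)
    (hp0.factorization_pos_of_dvd hb.ne' hpb) (hRs p0 hp0 hpa hpb).1 (hRt p0 hp0 hpa hpb).1
  obtain ⟨x0, y0, t1, t2, hcop, ex1, ex2, ey1, ey2⟩ := prop_decomp hs.1 ht.1 hcr
  have ht1 : 0 < t1 := by
    rcases Nat.eq_zero_or_pos t1 with h | h
    · have := hs.1; rw [ex1, h] at this; omega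
    · exact h
  have ht2 : 0 < t2 := by
    rcases Nat.eq_zero_or_pos t2 with h | h
    · have := ht.1; rw [ex2, h] at this; omega
    · exact h
  obtain ⟨u, v, huv, hU, hV⟩ := Nat.exists_coprime (a ^ x0) (b ^ y0)
  set D := (a ^ x0).gcd (b ^ y0) with hD
  have hu : 0 < u := by
    rcases Nat.eq_zero_or_pos u with h | h
    · have := pow_pos ha x0; rw [hU, h] at this; omega
    · exact h
  have hv : 0 < v := by
    rcases Nat.eq_zero_or_pos v with h | h
    · have := pow_pos hb y0; rw [hV, h] at this; omega
    · exact h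
  have hp2 : ∀ p : ℕ, p ∣ c → p ≠ 2 := by
    rintro p hpc rfl
    exact (Nat.not_even_iff_odd.mpr hodd) (even_iff_two_dvd.mpr hpc)
  have key : ∀ p : ℕ, p.Prime → p ∣ c → p ∣ u + v ∧ Odd t1 ∧ Odd t2 := fun p hp hpc =>
    plus_nat hp (hp2 p hpc) huv ht1.ne' hcop (Rc_dvd ha (by omega) hs hRs ex1 ey1 hU hV hp hpc)
      (Rc_dvd ha (by omega) ht hRt ex2 ey2 hU hV hp hpc)
  have back : ∀ (r : ℕ × ℕ × ℕ) (i : ℕ), IsSol a b c r → r.1 = x0 * i → r.2.1 = y0 * i →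
      ∀ p : ℕ, p.Prime → p ∣ u ^ i + v ^ i → p ∣ u + v := by
    intro r i hr e1 e2 p hp hpd
    refine (key p hp (hp.dvd_of_dvd_pow (n := r.2.2) ?_)).1
    have hE : D ^ i * (u ^ i + v ^ i) = c ^ r.2.2 := by
      rw [← hr.2.2.2, e1, e2, pow_mul, pow_mul, hU, hV]; ring
    rw [← hE]
    exact hpd.mul_left _
  obtain ⟨p1, hp1, hpc1⟩ := Nat.exists_prime_and_dvd hc.ne'
  obtain ⟨d1, o1, o2⟩ := key p1 hp1 hpc1
  have h3 : 3 ≤ u + v := by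
    have := Nat.le_of_dvd (by omega) d1
    have := hp1.two_le
    have := hp2 p1 hpc1
    omega
  have all3 : u + v = 3 → ∀ p : ℕ, p.Prime → p ∣ c → p = 3 := by
    intro h p hp hpc
    have := (key p hp hpc).1
    rw [h] at this
    exact (Nat.prime_dvd_prime_iff_eq hp Nat.prime_three).mp this
  rcases Nat.lt_or_ge 1 t1 with h1 | h1
  · obtain ⟨e1, e2⟩ := core_plus huv hu hv h3 h1 o1 (back s t1 hs ex1 ey1)
    right
    refine ⟨all3 e2, Or.inr ?_⟩
    rcases Nat.lt_or_ge 1 t2 with h2 | h2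
    · obtain ⟨e3, _⟩ := core_plus huv hu hv h3 h2 o2 (back t t2 ht ex2 ey2)
      rw [e1, e3] at hcop
      norm_num at hcop
    · obtain rfl : t2 = 1 := by omega
      rw [ex1, ex2, e1]; ring
  · obtain rfl : t1 = 1 := by omega
    rcases Nat.lt_or_ge 1 t2 with h2 | h2
    · obtain ⟨e3, e4⟩ := core_plus huv hu hv h3 h2 o2 (back t t2 ht ex2 ey2)
      right
      refine ⟨all3 e4, Or.inl ?_⟩
      rw [ex1, ex2, e3]; ring
    · obtain rfl : t2 = 1 := by omega
      left
      have f1 : s.1 = t.1 := by rw [ex1, ex2]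
      have f2 : s.2.1 = t.2.1 := by rw [ey1, ey2]
      have g1 := hs.2.2.2
      rw [f1, f2, ht.2.2.2] at g1
      have f3 := Nat.pow_right_injective hc g1
      ext
      · exact f1
      · exact f2
      · exact f3.symm

lemma Rb_dvd {a b c x0 z0 t u v D : ℕ} (ha : 0 < a) (hb : 0 < b)
    {s : ℕ × ℕ × ℕ} (hs : IsSol a b c s)
    (hR : Rb a b c s) (ex : s.1 = x0 * t) (ez : s.2.2 = z0 * t) (hU : c ^ z0 = u * D)
    (hV : a ^ x0 = v * D) (hlt : v < u) {p : ℕ} (hp : p.Prime) (hpb : p ∣ b) :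
    (p : ℤ) ∣ (u : ℤ) ^ t - (v : ℤ) ^ t := by
  have hle : v ^ t ≤ u ^ t := Nat.pow_le_pow_left hlt.le _
  have hE : D ^ t * (u ^ t - v ^ t) = b ^ s.2.1 := by
    have h1 : D ^ t * u ^ t = c ^ s.2.2 := by rw [ez, pow_mul, hU]; ring
    have h2 : D ^ t * v ^ t = a ^ s.1 := by rw [ex, pow_mul, hV]; ring
    have h3 := hs.2.2.2
    rw [Nat.mul_sub, h1, h2]; omega
  have hE0 : b ^ s.2.1 ≠ 0 := by positivity
  have main : p ∣ u ^ t - v ^ t := by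
    apply cof hp hE hE0
    by_cases hS : p ∣ a
    · have h1 := (hR p hp hS hpb).2
      have h2 : D ^ t ∣ a ^ s.1 := by
        rw [ex, pow_mul, hV, mul_pow]; exact Dvd.intro_left _ rfl
      have h3 := (Nat.factorization_le_iff_dvd (ne_zero_of_dvd_ne_zero hE0 (Dvd.intro _ hE))
        (by positivity)).mpr h2 p
      simp only [Nat.factorization_pow, Finsupp.smul_apply, smul_eq_mul] at h3 ⊢
      omega
    · have h1 : ¬ p ∣ D ^ t := by
        intro h
        have h2 := hp.dvd_of_dvd_pow h
        exact hS (hp.dvd_of_dvd_pow (hV ▸ h2.mul_left _))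
      rw [Nat.factorization_eq_zero_of_not_dvd h1]
      apply hp.factorization_pos_of_dvd hE0
      exact dvd_pow hpb hs.2.1.ne'
  have := Int.natCast_dvd_natCast.mpr main
  rw [Nat.cast_sub hle] at this
  exact_mod_cast this
lemma rb_contra {b D u v y1 y2 k p0 : ℕ} (hD : Odd D) (huv : u.Coprime v) (hlt : v < u)
    (hv : 0 < v) (hk : u + v = 2 ^ k) (hy1 : 0 < y1) (h1 : D * (u - v) = b ^ y1)
    (h2 : D ^ 2 * (u ^ 2 - v ^ 2) = b ^ y2) (hp0 : p0.Prime) (hp2 : p0 ≠ 2) (hpb : p0 ∣ b) :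
    False := by
  obtain ⟨d, rfl⟩ := Nat.exists_eq_add_of_lt hlt
  have hk2 : 2 ≤ k := by
    rcases k with _ | _ | k
    · simp at hk; omega
    · simp at hk; omega
    · omega
  have h4 : 4 ∣ v + d + 1 + v := by rw [hk]; exact pow_dvd_pow 2 hk2
  have hvo : v % 2 = 1 := by
    by_contra hvo
    have := Nat.eq_one_of_dvd_coprimes huv (show 2 ∣ v + d + 1 by omega) (show 2 ∣ v by omega)
    omega
  have e1 : v + d + 1 - v = d + 1 := by omega
  rw [e1] at h1
  have e2 : (v + d + 1) ^ 2 - v ^ 2 = (d + 1) * (v + d + 1 + v) := by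
    rw [Nat.sq_sub_sq, e1]; ring
  rw [e2] at h2
  have hd : (d + 1) % 4 = 2 := by omega
  have hb4 : b ^ y1 % 4 = 2 := by
    rw [← h1, Nat.mul_mod, hd]
    obtain ⟨m, rfl⟩ := hD
    omega
  have hy : y1 = 1 := by
    by_contra hne
    have hb2 : 2 ∣ b := Nat.prime_two.dvd_of_dvd_pow (n := y1) (by omega)
    have : 2 ^ 2 ∣ b ^ y1 := (pow_dvd_pow_of_dvd hb2 2).trans (pow_dvd_pow b (by omega))
    omega
  rw [hy, pow_one] at h1
  have hb0 : 0 < b := by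
    rw [← h1]
    have := hD.pos
    positivity
  have h3 : b ^ y2 * (d + 1) = b ^ 2 * 2 ^ k := by
    rw [← h2, ← hk, ← h1]; ring
  have hy2 : 3 ≤ y2 := by
    by_contra hcon
    have : b ^ y2 ≤ b ^ 2 := Nat.pow_le_pow_right hb0 (by omega)
    have h5 : d + 1 < 2 ^ k := by omega
    have h6 : 0 < b ^ 2 := by positivity
    nlinarith
  obtain ⟨m, rfl⟩ := Nat.exists_eq_add_of_le hy2
  have h5 : b ^ (m + 1) * (d + 1) = 2 ^ k := by
    apply Nat.eq_of_mul_eq_mul_left (show 0 < b ^ 2 by positivity)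
    rw [← h3]; ring
  have h6 : p0 ∣ 2 ^ k := by
    rw [← h5]
    exact (dvd_pow hpb (by omega)).mul_right _
  exact hp2 ((Nat.prime_dvd_prime_iff_eq hp0 Nat.prime_two).mp (hp0.dvd_of_dvd_pow h6))

lemma Rb_pair {a b c : ℕ} (ha : 0 < a) (hb : 0 < b) (hc : 1 < c) (hodd : Odd c)
    (hS : ∀ p : ℕ, p.Prime → p ∣ a → p ∣ b → p ∣ c)
    {p0 : ℕ} (hp0 : p0.Prime) (hpa : p0 ∣ a) (hpb : p0 ∣ b) {s t : ℕ × ℕ × ℕ}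
    (hs : IsSol a b c s) (ht : IsSol a b c t) (hRs : Rb a b c s) (hRt : Rb a b c t) :
    s = t := by
  have hcr := cross_eq (hp0.factorization_pos_of_dvd ha.ne' hpa)
    (hp0.factorization_pos_of_dvd (by omega) (hS p0 hp0 hpa hpb)) (hRs p0 hp0 hpa hpb).1
    (hRt p0 hp0 hpa hpb).1
  obtain ⟨x0, z0, t1, t2, hcop, ex1, ex2, ez1, ez2⟩ := prop_decomp hs.1 ht.1 hcr
  have ht1 : 0 < t1 := by
    rcases Nat.eq_zero_or_pos t1 with h | h
    · have := hs.1; rw [ex1, h] at this; omega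
    · exact h
  have ht2 : 0 < t2 := by
    rcases Nat.eq_zero_or_pos t2 with h | h
    · have := ht.1; rw [ex2, h] at this; omega
    · exact h
  obtain ⟨u, v, huv, hU, hV⟩ := Nat.exists_coprime (c ^ z0) (a ^ x0)
  set D := (c ^ z0).gcd (a ^ x0) with hD
  have hDo : Odd D := (hodd.pow (n := z0)).of_dvd_nat (Nat.gcd_dvd_left _ _)
  have hv : 0 < v := by
    rcases Nat.eq_zero_or_pos v with h | h
    · have := pow_pos ha x0; rw [hV, h] at this; omega
    · exact h
  have hlt : v < u := by
    have h1 : (a ^ x0) ^ t1 < (c ^ z0) ^ t1 := by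
      rw [← pow_mul, ← pow_mul, ← ex1, ← ez1, ← hs.2.2.2]
      have := pow_pos hb s.2.1
      omega
    have h2 := lt_of_pow_lt_pow_left₀ t1 (by positivity) h1
    rw [hU, hV] at h2
    exact Nat.lt_of_mul_lt_mul_right h2
  have hp2 : p0 ≠ 2 := by
    rintro rfl
    exact (Nat.not_even_iff_odd.mpr hodd) (even_iff_two_dvd.mpr (hS 2 hp0 hpa hpb))
  have key : ∀ p : ℕ, p.Prime → p ∣ b → (p : ℤ) ∣ (u : ℤ) - v := fun p hp hpb =>
    minus_int hp huv ht1.ne' hcop (Rb_dvd ha hb hs hRs ex1 ez1 hU hV hlt hp hpb)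
      (Rb_dvd ha hb ht hRt ex2 ez2 hU hV hlt hp hpb)
  have eqn : ∀ (r : ℕ × ℕ × ℕ) (i : ℕ), IsSol a b c r → r.1 = x0 * i → r.2.2 = z0 * i →
      D ^ i * (u ^ i - v ^ i) = b ^ r.2.1 := by
    intro r i hr e1 e2
    have h1 : D ^ i * u ^ i = c ^ r.2.2 := by rw [e2, pow_mul, hU]; ring
    have h2 : D ^ i * v ^ i = a ^ r.1 := by rw [e1, pow_mul, hV]; ring
    have h3 := hr.2.2.2
    rw [Nat.mul_sub, h1, h2]; omega
  have back : ∀ (r : ℕ × ℕ × ℕ) (i : ℕ), IsSol a b c r → r.1 = x0 * i → r.2.2 = z0 * i →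
      ∀ p : ℕ, p.Prime → (p : ℤ) ∣ (u : ℤ) ^ i - (v : ℤ) ^ i → (p : ℤ) ∣ (u : ℤ) - v := by
    intro r i hr e1 e2 p hp hpd
    refine key p hp (hp.dvd_of_dvd_pow (n := r.2.1) ?_)
    rw [← eqn r i hr e1 e2]
    have hle : v ^ i ≤ u ^ i := Nat.pow_le_pow_left hlt.le _
    have : (p : ℤ) ∣ ((u ^ i - v ^ i : ℕ) : ℤ) := by
      rw [Nat.cast_sub hle]; push_cast; exact hpd
    exact (Int.natCast_dvd_natCast.mp this).mul_left _
  rcases Nat.lt_or_ge 1 t1 with h1 | h1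
  · exfalso
    obtain ⟨rfl, k, hk⟩ := core_minus huv hv hlt h1 (back s t1 hs ex1 ez1)
    rcases Nat.lt_or_ge 1 t2 with h2 | h2
    · obtain ⟨rfl, _⟩ := core_minus huv hv hlt h2 (back t t2 ht ex2 ez2)
      norm_num at hcop
    · obtain rfl : t2 = 1 := by omega
      have g1 := eqn s 2 hs ex1 ez1
      have g2 := eqn t 1 ht ex2 ez2
      simp only [pow_one] at g2
      exact rb_contra hDo huv hlt hv hk ht.2.1 g2 g1 hp0 hp2 hpb
  · obtain rfl : t1 = 1 := by omega
    rcases Nat.lt_or_ge 1 t2 with h2 | h2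
    · exfalso
      obtain ⟨rfl, k, hk⟩ := core_minus huv hv hlt h2 (back t t2 ht ex2 ez2)
      have g1 := eqn t 2 ht ex2 ez2
      have g2 := eqn s 1 hs ex1 ez1
      simp only [pow_one] at g2
      exact rb_contra hDo huv hlt hv hk hs.2.1 g2 g1 hp0 hp2 hpb
    · obtain rfl : t2 = 1 := by omega
      have f1 : s.1 = t.1 := by rw [ex1, ex2]
      have f2 : s.2.2 = t.2.2 := by rw [ez1, ez2]
      have g1 := hs.2.2.2
      rw [f1, f2, ← ht.2.2.2] at g1
      have hb2 : 1 < b := lt_of_lt_of_le hp0.one_lt (Nat.le_of_dvd hb hpb)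
      have f3 := Nat.pow_right_injective hb2 (Nat.add_left_cancel g1)
      ext
      · exact f1
      · exact f3
      · exact f2

lemma IsSol_swap {a b c : ℕ} {s : ℕ × ℕ × ℕ} (hs : IsSol a b c s) :
    IsSol b a c (s.2.1, s.1, s.2.2) :=
  ⟨hs.2.1, hs.1, hs.2.2.1, by rw [add_comm]; exact hs.2.2.2⟩

lemma Ra_pair {a b c : ℕ} (ha : 0 < a) (hb : 0 < b) (hc : 1 < c) (hodd : Odd c)
    (hS : ∀ p : ℕ, p.Prime → p ∣ a → p ∣ b → p ∣ c)
    {p0 : ℕ} (hp0 : p0.Prime) (hpa : p0 ∣ a) (hpb : p0 ∣ b) {s t : ℕ × ℕ × ℕ}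
    (hs : IsSol a b c s) (ht : IsSol a b c t) (hRs : Ra a b c s) (hRt : Ra a b c t) :
    s = t := by
  have := Rb_pair hb ha hc hodd (fun p hp h1 h2 => hS p hp h2 h1) hp0 hpb hpa
    (IsSol_swap hs) (IsSol_swap ht) (fun p hp h1 h2 => hRs p hp h2 h1)
    (fun p hp h1 h2 => hRt p hp h2 h1)
  simp only [Prod.mk.injEq] at this
  ext
  · exact this.2.1
  · exact this.1
  · exact this.2.2

lemma noncoprime_bound {a b c : ℕ} (ha : 0 < a) (hb : 0 < b) (hc : 1 < c) (hodd : Odd c)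
    (hS : ∀ p : ℕ, p.Prime → p ∣ a → p ∣ b → p ∣ c)
    {p0 : ℕ} (hp0 : p0.Prime) (hpa : p0 ∣ a) (hpb : p0 ∣ b) :
    {s | IsSol a b c s}.ncard ≤ 2 ^ c.primeFactors.card := by
  classical
  have hcard : 0 < c.primeFactors.card := by
    rw [Finset.card_pos, Nat.nonempty_primeFactors]; exact hc
  rcases Nat.lt_or_ge 1 c.primeFactors.card with hw | hw
  · have h4 : 2 ^ 2 ≤ 2 ^ c.primeFactors.card := Nat.pow_le_pow_right (by norm_num) hw
    refine le_trans ?_ h4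
    have : Fintype.card (Fin 4) = 2 ^ 2 := by simp
    rw [← this]
    refine ncard_le_of_inj _ (fun s => if Rc a b c s then (0 : Fin 4) else if Rb a b c s then 1 else
      if Ra a b c s then 2 else 3) ?_
    intro s hs t ht h
    have hcc : Rc a b c s → Rc a b c t → s = t := by
      intro h1 h2
      rcases Rc_pair ha hb hc hodd hp0 hpa hpb hs ht h1 h2 with h3 | ⟨h3, _⟩
      · exact h3
      · exfalso
        have hsub : c.primeFactors ⊆ {3} := by
          intro p hp
          rw [Finset.mem_singleton]
          exact h3 p (Nat.prime_of_mem_primeFactors hp) (Nat.dvd_of_mem_primeFactors hp)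
        have := Finset.card_le_card hsub
        rw [Finset.card_singleton] at this
        omega
    have hbb : Rb a b c s → Rb a b c t → s = t := Rb_pair ha hb hc hodd hS hp0 hpa hpb hs ht
    have haa : Ra a b c s → Ra a b c t → s = t := Ra_pair ha hb hc hodd hS hp0 hpa hpb hs ht
    have hmm := mixed_unique ha hb hS hs ht
    split_ifs at h with g1 g2 g3 g4 g5 g6 g7 g8 g9 g10 g11 g12 g13 g14 g15
    all_goals first
      | (exfalso; revert h; decide)
      | tauto
  · have h1 : c.primeFactors.card = 1 := by omega
    rw [h1, pow_one]
    have hpc0 := hS p0 hp0 hpa hpb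
    obtain ⟨r, hr⟩ := Finset.card_eq_one.mp h1
    have uniq : ∀ p : ℕ, p.Prime → p ∣ c → p = p0 := by
      intro p hp hpc
      have m1 : p ∈ c.primeFactors := Nat.mem_primeFactors.mpr ⟨hp, hpc, by omega⟩
      have m2 : p0 ∈ c.primeFactors := Nat.mem_primeFactors.mpr ⟨hp0, hpc0, by omega⟩
      rw [hr, Finset.mem_singleton] at m1 m2
      rw [m1, m2]
    have hcp : ∃ n, c = p0 ^ n :=
      ⟨_, Nat.eq_prime_pow_of_unique_prime_dvd (by omega) (fun {d} hd hdn => uniq d hd hdn)⟩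
    obtain ⟨n, hn⟩ := hcp
    have allRc : ∀ s, IsSol a b c s → Rc a b c s := by
      intro s hs p hp hpa' hpb'
      obtain rfl := uniq p hp (hS p hp hpa' hpb')
      have hT := sol_Tm hp ha hb hs
      by_contra hcon
      have hle : s.2.2 * c.factorization p ≤ s.1 * a.factorization p ∧
          s.2.2 * c.factorization p ≤ s.2.1 * b.factorization p := by
        unfold Tm at hT; omega
      have hcz : c ^ s.2.2 = p ^ (s.2.2 * c.factorization p) := by
        have : c.factorization p = n := by rw [hn, hp.factorization_pow]; simp
        rw [this]
        conv_lhs => rw [hn]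
        rw [← pow_mul, mul_comm]
      have d1 : c ^ s.2.2 ∣ a ^ s.1 := by
        rw [hcz, hp.pow_dvd_iff_le_factorization (by positivity)]
        simpa [Nat.factorization_pow] using hle.1
      have d2 : c ^ s.2.2 ∣ b ^ s.2.1 := by
        rw [hcz, hp.pow_dvd_iff_le_factorization (by positivity)]
        simpa [Nat.factorization_pow] using hle.2
      have l1 := Nat.le_of_dvd (by positivity) d1
      have l2 := Nat.le_of_dvd (by positivity) d2
      have l3 := hs.2.2.2
      have : 0 < c ^ s.2.2 := by positivity
      omega
    refine ncard_le_of_inj (T := Bool) _ (fun s => decide (padicValNat 3 s.1 % 2 = 0)) ?_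
    intro s hs t ht h
    rw [decide_eq_decide] at h
    rcases Rc_pair ha hb hc hodd hp0 hpa hpb hs ht (allRc s hs) (allRc t ht) with h3 | ⟨_, h3⟩
    · exact h3
    · exfalso
      have : Fact (Nat.Prime 3) := ⟨Nat.prime_three⟩
      have aux : ∀ m : ℕ, 0 < m → padicValNat 3 (3 * m) = 1 + padicValNat 3 m := by
        intro m hm
        rw [padicValNat.mul (by norm_num) (by omega), padicValNat_self]
      rcases h3 with h3 | h3
      · rw [h3, aux _ hs.1] at h; omega
      · rw [h3, aux _ ht.1] at h; omega

theorem stmt1 (a b c : ℕ) (ha : 0 < a) (hb : 0 < b) (hc : 0 < c) (hodd : Odd c) :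
    Set.ncard {p : ℕ × ℕ × ℕ | 0 < p.1 ∧ 0 < p.2.1 ∧ 0 < p.2.2 ∧
      a ^ p.1 + b ^ p.2.1 = c ^ p.2.2} ≤ 2 ^ c.primeFactors.card := by
  change Set.ncard {s | IsSol a b c s} ≤ _
  rcases Set.eq_empty_or_nonempty {s | IsSol a b c s} with he | ⟨s, hs⟩
  · rw [he]; simp
  have hs : IsSol a b c s := hs
  have hc1 : 1 < c := by
    by_contra hcon
    obtain rfl : c = 1 := by omega
    have h := hs.2.2.2
    have := pow_pos ha s.1
    have := pow_pos hb s.2.1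
    rw [one_pow] at h
    omega
  have hS : ∀ p : ℕ, p.Prime → p ∣ a → p ∣ b → p ∣ c := by
    intro p hp h1 h2
    apply hp.dvd_of_dvd_pow (n := s.2.2)
    rw [← hs.2.2.2]
    exact dvd_add (dvd_pow h1 hs.1.ne') (dvd_pow h2 hs.2.1.ne')
  by_cases hab : a.Coprime b
  · rcases Nat.lt_or_ge 1 a with ha2 | ha2
    · rcases Nat.lt_or_ge 1 b with hb2 | hb2
      · have hac : a.Coprime c := by
          apply Nat.coprime_of_dvd
          intro p hp h1 h2
          have h3 : p ∣ b := by
            apply hp.dvd_of_dvd_pow (n := s.2.1)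
            rw [← Nat.dvd_add_right (dvd_pow h1 hs.1.ne'), hs.2.2.2]
            exact dvd_pow h2 hs.2.2.1.ne'
          exact hp.one_lt.ne' (Nat.eq_one_of_dvd_coprimes hab h1 h3)
        have hbc : b.Coprime c := by
          apply Nat.coprime_of_dvd
          intro p hp h1 h2
          have h3 : p ∣ a := by
            apply hp.dvd_of_dvd_pow (n := s.1)
            rw [← Nat.dvd_add_left (dvd_pow h1 hs.2.1.ne'), hs.2.2.2]
            exact dvd_pow h2 hs.2.2.1.ne'
          exact hp.one_lt.ne' (Nat.eq_one_of_dvd_coprimes hab h3 h1)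
        exact coprime_bound ha2 hb2 hc1 hodd hab hac hbc
      · obtain rfl : b = 1 := by omega
        have : Set.Infinite {s | IsSol a 1 c s} := by
          apply Set.infinite_of_injective_forall_mem (f := fun n : ℕ => (s.1, n + 1, s.2.2))
          · intro m n h
            simpa using h
          · intro n
            refine ⟨hs.1, Nat.succ_pos n, hs.2.2.1, ?_⟩
            have := hs.2.2.2
            simpa using this
        rw [this.ncard]; exact Nat.zero_le _
    · obtain rfl : a = 1 := by omega
      have : Set.Infinite {s | IsSol 1 b c s} := by
        apply Set.infinite_of_injective_forall_mem (f := fun n : ℕ => (n + 1, s.2.1, s.2.2))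
        · intro m n h
          simpa using h
        · intro n
          refine ⟨Nat.succ_pos n, hs.2.1, hs.2.2.1, ?_⟩
          have := hs.2.2.2
          simpa using this
      rw [this.ncard]; exact Nat.zero_le _
  · obtain ⟨p0, hp0, hpa, hpb⟩ := Nat.Prime.not_coprime_iff_dvd.mp hab
    exact noncoprime_bound ha hb hc1 hodd hS hp0 hpa hpb
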